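/- Let p ∈ (0,1), α = 1/p − 1, s = ⌊nα⌋. A function g is a pointwise multiplier of Λ_{nα}(ℝⁿ) (with ‖gf‖_{Λ_{nα}} ≤ C(‖g‖_{L^∞} + ‖g‖_{L_loc^{Φ_p}})‖f‖_{Λ_{nα}} for all f) if and only if g ∈ L^∞(ℝⁿ) ∩ L_loc^{Φ_p}(ℝⁿ). -/

import Mathlib

open MeasureTheory

/-- The Orlicz function `Φ_p(τ) = τ / (1 + τ^(1-p))`. -/
noncomputable def PhiP (p τ : ℝ) : ℝ := τ / (1 + τ ^ (1 - p))

/-- The Luxemburg quasi-norm with respect to `Φ_p` on `ℝⁿ`. -/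
noncomputable def luxNorm (n : ℕ) (p : ℝ) (f : EuclideanSpace ℝ (Fin n) → ℝ) : ℝ :=
  sInf {lam : ℝ | 0 < lam ∧ ∫ x, PhiP p (|f x| / lam) ≤ 1}

/-- Evaluation of a real polynomial in `n` variables at a point of `ℝⁿ`. -/
noncomputable def mvEval {n : ℕ} (x : EuclideanSpace ℝ (Fin n))
    (P : MvPolynomial (Fin n) ℝ) : ℝ :=
  MvPolynomial.eval (fun i => x i) P

/-- Iterated difference operator: `D_h^k f`. -/
def iterDiff {n : ℕ} (h : EuclideanSpace ℝ (Fin n)) (f : EuclideanSpace ℝ (Fin n) → ℝ) :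
    ℕ → EuclideanSpace ℝ (Fin n) → ℝ
  | 0 => f
  | k + 1 => fun x => iterDiff h f k (x + h) - iterDiff h f k x

/-- `f` belongs to the inhomogeneous Lipschitz space `Λ_β(ℝⁿ)` with `L^∞`-bound `Mf` and
difference-quotient bound `L`: it has a continuous representative `f₀` with `|f₀| ≤ Mf` and
`|D_h^{⌊β⌋+1} f₀(x)| ≤ L |h|^β`; thus `‖f‖_{Λ_β} ≤ Mf + L`. -/
def MemLipWith (n : ℕ) (β Mf L : ℝ) (f : EuclideanSpace ℝ (Fin n) → ℝ) : Prop :=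
  ∃ f₀ : EuclideanSpace ℝ (Fin n) → ℝ, Continuous f₀ ∧ (∀ᵐ x, f x = f₀ x) ∧
    (∀ x, |f₀ x| ≤ Mf) ∧
    ∀ (x h : EuclideanSpace ℝ (Fin n)), h ≠ 0 →
      |iterDiff h f₀ (⌊β⌋₊ + 1) x| ≤ L * ‖h‖ ^ β

/-- `g` belongs to the local Orlicz–Campanato space `L_loc^{Φ_p}(ℝⁿ)` with norm bound `K`:
for balls of measure `< 1` the oscillation of `g` against its minimizing polynomial `P_B^s g`
of degree `≤ s = ⌊n(1/p−1)⌋`, and for balls of measure `≥ 1` the integral of `|g|`, are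
bounded by `K ‖1_B‖_{L^{Φ_p}}`. -/
def MemOrlCampWith (n : ℕ) (p K : ℝ) (g : EuclideanSpace ℝ (Fin n) → ℝ) : Prop :=
  (∀ (x₀ : EuclideanSpace ℝ (Fin n)) (r : ℝ), 0 < r →
    (volume (Metric.ball x₀ r)).toReal < 1 →
    ∀ P : MvPolynomial (Fin n) ℝ, P.totalDegree ≤ ⌊(n : ℝ) * (1 / p - 1)⌋₊ →
      (∀ R : MvPolynomial (Fin n) ℝ, R.totalDegree ≤ ⌊(n : ℝ) * (1 / p - 1)⌋₊ →
        ∫ x in Metric.ball x₀ r, (g x - mvEval x P) * mvEval x R = 0) →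
      ∫ x in Metric.ball x₀ r, |g x - mvEval x P| ≤
        K * luxNorm n p ((Metric.ball x₀ r).indicator fun _ => (1 : ℝ))) ∧
  (∀ (x₀ : EuclideanSpace ℝ (Fin n)) (r : ℝ), 0 < r →
    1 ≤ (volume (Metric.ball x₀ r)).toReal →
    ∫ x in Metric.ball x₀ r, |g x| ≤
      K * luxNorm n p ((Metric.ball x₀ r).indicator fun _ => (1 : ℝ)))

theorem iterDiff_eq_iterate {n : ℕ} (h : EuclideanSpace ℝ (Fin n))
    (f : EuclideanSpace ℝ (Fin n) → ℝ) (k : ℕ) :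
    iterDiff h f k = (fwdDiff h)^[k] f := by
  induction k with
  | zero => rfl
  | succ k ih => rw [Function.iterate_succ_apply', ← ih]; rfl

/-- Discrete Landau inequality for bounded sequences. -/
theorem sq_sub_le_of_abs_le_of_second_diff_le (a : ℕ → ℝ) {A e : ℝ} (hA : ∀ m, |a m| ≤ A)
    (he : ∀ m, |a (m + 2) - 2 * a (m + 1) + a m| ≤ e) : (a 1 - a 0) ^ 2 ≤ 4 * A * e := by
  wlog hd : 0 ≤ a 1 - a 0 generalizing a
  · have := this (fun m => - a m) (fun m => by simpa using hA m)
      (fun m => by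
        have := he m
        rw [← abs_neg] at this
        convert this using 2; ring) (by simp at hd ⊢; linarith)
    convert this using 1; ring
  have hA0 : 0 ≤ A := (abs_nonneg _).trans (hA 0)
  have he0 : 0 ≤ e := (abs_nonneg _).trans (he 0)
  set d := a 1 - a 0 with hdd
  have h1 : ∀ m : ℕ, d - m * e ≤ a (m + 1) - a m := by
    intro m
    induction m with
    | zero => simp [hdd]
    | succ m ih =>
      have := (abs_le.1 (he m)).1
      push_cast
      linarith
  have h2 : ∀ N : ℕ, N * d - e * (N * (N - 1) / 2) ≤ a N - a 0 := by
    intro N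
    induction N with
    | zero => simp
    | succ m ih =>
      have := h1 m
      push_cast
      linarith
  have h3 : ∀ N : ℕ, N * d - e * (N * (N - 1) / 2) ≤ 2 * A := by
    intro N
    have := (abs_le.1 (hA N)).2
    have := (abs_le.1 (hA 0)).1
    linarith [h2 N]
  rcases he0.eq_or_lt with he1 | he1
  · have hd0 : d = 0 := by
      by_contra hne
      have hdpos : 0 < d := lt_of_le_of_ne hd (Ne.symm hne)
      obtain ⟨N, hN⟩ := exists_nat_gt (2 * A / d)
      rw [div_lt_iff₀ hdpos] at hN
      have := h3 N
      rw [← he1] at this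
      linarith
    rw [hd0, ← he1]; simp
  · have hN1 := Nat.floor_le (div_nonneg hd he0)
    have hN2 := Nat.lt_floor_add_one (d / e)
    have := h3 (⌊d / e⌋₊ + 1)
    set N := ⌊d / e⌋₊
    push_cast at this
    rw [le_div_iff₀ he1] at hN1
    rw [div_lt_iff₀ he1] at hN2
    have h4 : ((N : ℝ) + 1) * d / 2 ≤ 2 * A := by
      have : 0 ≤ ((N : ℝ) + 1) * (d - N * e) := by
        apply mul_nonneg (by positivity) (by linarith)
      linarith
    nlinarith

theorem le_of_sq_le_mul_of_le {b : ℕ → ℝ} {k : ℕ} {B : ℝ} (hb : ∀ j, 0 ≤ b j)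
    (hlc : ∀ j, j + 1 < k → b (j + 1) ^ 2 ≤ b j * b (j + 2)) (h0 : b 0 ≤ B) (hk : b k ≤ B) :
    ∀ j ≤ k, b j ≤ B := by
  have hstep : ∀ j, j + 1 ≤ k → B < b (j + 1) → b j ≤ b (j + 1) →
      False ∨ ∀ m, j + 1 ≤ m → m ≤ k → B < b m ∧ b (m - 1) ≤ b m := by
    intro j hj hB hle
    right
    intro m hm
    induction m, hm using Nat.le_induction with
    | base => intro _; exact ⟨hB, by simpa using hle⟩
    | succ m hm ih =>
      intro hmk
      obtain ⟨h1, h2⟩ := ih (by omega)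
      obtain ⟨i, rfl⟩ : ∃ i, m = i + 1 := ⟨m - 1, by omega⟩
      have h3 := hlc i (by omega)
      simp only [Nat.add_sub_cancel] at h2 ⊢
      have h4 : 0 < b (i + 1) := lt_of_le_of_lt ((hb 0).trans h0) h1
      have h5 : b (i + 1) ≤ b (i + 2) := by
        by_contra hlt
        push Not at hlt
        nlinarith [hb i, hb (i + 2)]
      exact ⟨lt_of_lt_of_le h1 h5, h5⟩
  intro j
  induction j with
  | zero => intro _; exact h0
  | succ j ih =>
    intro hj
    by_contra hlt
    push Not at hlt
    rcases hstep j hj hlt ((ih (by omega)).trans hlt.le) with h | h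
    · exact h
    · exact absurd hk (not_le.2 (h k hj le_rfl).1)

theorem abs_fwdDiff_iter_le {E : Type*} [AddCommGroup E] {f : E → ℝ} {A : ℝ}
    (hf : ∀ x, |f x| ≤ A) (h : E) (k : ℕ) : ∀ x, |(fwdDiff h)^[k] f x| ≤ 2 ^ k * A := by
  induction k with
  | zero => simpa using hf
  | succ k ih =>
    intro x
    rw [Function.iterate_succ_apply', fwdDiff, pow_succ]
    have h1 := abs_le.1 (ih (x + h))
    have h2 := abs_le.1 (ih x)
    rw [abs_le]
    constructor <;> linarith [h1.1, h1.2, h2.1, h2.2]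

/-- Kolmogorov-type interpolation for iterated differences. -/
theorem abs_fwdDiff_iter_le_of_le {E : Type*} [AddCommGroup E] {f : E → ℝ} {A t : ℝ} (ht : 0 < t)
    (hA : 0 ≤ A) (h : E) (k : ℕ) (hf : ∀ x, |f x| ≤ A)
    (hk : ∀ x, |(fwdDiff h)^[k] f x| ≤ A * t ^ k) :
    ∀ j ≤ k, ∀ x, |(fwdDiff h)^[j] f x| ≤ 2 ^ (k ^ 2) * A * t ^ j := by
  set N : ℕ → ℝ := fun j => ⨆ x, |(fwdDiff h)^[j] f x| with hN
  have hbdd : ∀ j, BddAbove (Set.range fun x => |(fwdDiff h)^[j] f x|) := fun j =>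
    ⟨2 ^ j * A, by rintro _ ⟨x, rfl⟩; exact abs_fwdDiff_iter_le hf h j x⟩
  have hle : ∀ j x, |(fwdDiff h)^[j] f x| ≤ N j := fun j x => le_ciSup (hbdd j) x
  have hN0 : ∀ j, 0 ≤ N j := fun j => (abs_nonneg _).trans (hle j 0)
  have hland : ∀ j, N (j + 1) ^ 2 ≤ 4 * N j * N (j + 2) := by
    intro j
    have : N (j + 1) ≤ Real.sqrt (4 * N j * N (j + 2)) := by
      apply ciSup_le
      intro x
      apply Real.abs_le_sqrt
      have h1 := sq_sub_le_of_abs_le_of_second_diff_le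
        (fun m : ℕ => (fwdDiff h)^[j] f (x + m • h)) (A := N j) (e := N (j + 2))
        (fun m => hle j _) (fun m => by
          have := hle (j + 2) (x + m • h)
          rw [Function.iterate_succ_apply', Function.iterate_succ_apply'] at this
          simp only [fwdDiff] at this
          convert this using 2
          have e1 : x + (m + 2) • h = x + m • h + h + h := by rw [add_smul]; abel
          have e2 : x + (m + 1) • h = x + m • h + h := by rw [add_smul]; abel
          rw [e1, e2]; ring)
      simpa [Function.iterate_succ_apply', fwdDiff] using h1
    calc N (j + 1) ^ 2 ≤ Real.sqrt (4 * N j * N (j + 2)) ^ 2 := by gcongr; exact hN0 _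
      _ = _ := Real.sq_sqrt (by have := hN0 j; have := hN0 (j+2); positivity)
  have key := le_of_sq_le_mul_of_le (b := fun j => 2 ^ (j ^ 2) * N j / t ^ j) (k := k)
    (B := 2 ^ (k ^ 2) * A)
    (fun j => by have := hN0 j; positivity)
    (fun j _ => by
      have h1 := hland j
      have : (2 ^ ((j + 1) ^ 2) * N (j + 1) / t ^ (j + 1)) ^ 2
        = (4 : ℝ) ^ (j + 1) ^ 2 / (t ^ (j + 1)) ^ 2 * N (j + 1) ^ 2 := by
        rw [div_pow, mul_pow, ← pow_mul, mul_comm _ 2, pow_mul]; norm_num; ring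
      rw [this]
      have : 2 ^ (j ^ 2) * N j / t ^ j * (2 ^ ((j + 2) ^ 2) * N (j + 2) / t ^ (j + 2))
        = (4 : ℝ) ^ (j + 1) ^ 2 / (t ^ (j + 1)) ^ 2 * (4 * N j * N (j + 2)) := by
        have e1 : (4 : ℝ) ^ (j + 1) ^ 2 * 4 = 2 ^ (j ^ 2) * 2 ^ ((j + 2) ^ 2) := by
          rw [← pow_succ, ← pow_add, show (4 : ℝ) = 2 ^ 2 by norm_num, ← pow_mul]; congr 1; ring
        have e2 : (t ^ (j + 1)) ^ 2 = t ^ j * t ^ (j + 2) := by ring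
        rw [e2, div_mul_div_comm]
        rw [div_mul_eq_mul_div]
        congr 1
        calc _ = 2 ^ (j ^ 2) * 2 ^ ((j + 2) ^ 2) * (N j * N (j + 2)) := by ring
          _ = _ := by rw [← e1]; ring
      rw [this]
      gcongr)
    (by
      simp only [ne_eq, OfNat.ofNat_ne_zero, not_false_eq_true, zero_pow, pow_zero, one_mul, div_one]
      have : N 0 ≤ A := ciSup_le fun x => by simpa using hf x
      have h2 : (1 : ℝ) ≤ 2 ^ (k ^ 2) := one_le_pow₀ (by norm_num)
      nlinarith)
    (by
      have : N k ≤ A * t ^ k := ciSup_le hk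
      rw [div_le_iff₀ (by positivity), mul_assoc]
      gcongr)
  intro j hj x
  have h1 := key j hj
  rw [div_le_iff₀ (by positivity)] at h1
  have h2 : (1 : ℝ) ≤ 2 ^ (j ^ 2) := one_le_pow₀ (by norm_num)
  refine (hle j x).trans (le_trans ?_ h1)
  nlinarith [hN0 j]

theorem abs_fwdDiff_iter_mul_le {E : Type*} [AddCommGroup E] {t : ℝ} (ht : 0 < t) (h : E) (k : ℕ) :
    ∀ (u v : E → ℝ) (A B : ℝ), 0 ≤ A → 0 ≤ B →
      (∀ j ≤ k, ∀ x, |(fwdDiff h)^[j] u x| ≤ A * t ^ j) →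
      (∀ j ≤ k, ∀ x, |(fwdDiff h)^[j] v x| ≤ B * t ^ j) →
      ∀ x, |(fwdDiff h)^[k] (fun x => u x * v x) x| ≤ 2 ^ k * A * B * t ^ k := by
  induction k with
  | zero =>
    intro u v A B hA hB hu hv x
    have h1 := hu 0 le_rfl x
    have h2 := hv 0 le_rfl x
    simp only [Function.iterate_zero, id_eq, pow_zero, mul_one, one_mul, abs_mul] at *
    gcongr
  | succ k ih =>
    intro u v A B hA hB hu hv x
    have hmul : fwdDiff h (fun x => u x * v x)
        = (fun x => fwdDiff h u x * v (x + h)) + fun x => u x * fwdDiff h v x := by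
      ext x; simp only [fwdDiff, Pi.add_apply]; ring
    rw [Function.iterate_succ_apply, hmul, fwdDiff_iter_add, Pi.add_apply]
    have h1 := ih (fwdDiff h u) (fun x => v (x + h)) (A * t) B (by positivity) hB
      (fun j hj x => by
        rw [← Function.iterate_succ_apply]
        exact (hu (j + 1) (by omega) x).trans_eq (by ring))
      (fun j hj x => by
        rw [fwdDiff_iter_comp_add]
        exact hv j (by omega) _) x
    have h2 := ih u (fwdDiff h v) A (B * t) hA (by positivity)
      (fun j hj x => hu j (by omega) x)
      (fun j hj x => by
        rw [← Function.iterate_succ_apply]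
        exact (hv (j + 1) (by omega) x).trans_eq (by ring)) x
    refine (abs_add_le _ _).trans ((add_le_add h1 h2).trans_eq ?_)
    ring

theorem abs_iterDiff_mul_le {n k : ℕ} (hk : 0 < k) {β : ℝ} {f g : EuclideanSpace ℝ (Fin n) → ℝ}
    {Mf L Mg Lg : ℝ} (hMf : 0 ≤ Mf) (hL : 0 ≤ L) (hMg : 0 ≤ Mg) (hLg : 0 ≤ Lg)
    (hf : ∀ x, |f x| ≤ Mf) (hg : ∀ x, |g x| ≤ Mg) {h : EuclideanSpace ℝ (Fin n)} (hh : h ≠ 0)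
    (hfk : ∀ x, |iterDiff h f k x| ≤ L * ‖h‖ ^ β) (hgk : ∀ x, |iterDiff h g k x| ≤ Lg * ‖h‖ ^ β)
    (x : EuclideanSpace ℝ (Fin n)) :
    |iterDiff h (fun x => g x * f x) k x| ≤
      2 ^ k * (2 ^ (k ^ 2) * (Mg + Lg)) * (2 ^ (k ^ 2) * (Mf + L)) * ‖h‖ ^ β := by
  have hpos : 0 < ‖h‖ := norm_pos_iff.2 hh
  set t := ‖h‖ ^ (β / k) with ht
  have htk : t ^ k = ‖h‖ ^ β := by
    rw [ht, ← Real.rpow_natCast, ← Real.rpow_mul hpos.le]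
    congr 1
    field_simp
  have htpos : 0 < t := Real.rpow_pos_of_pos hpos _
  have hβ : 0 < ‖h‖ ^ β := Real.rpow_pos_of_pos hpos _
  simp only [iterDiff_eq_iterate] at hfk hgk ⊢
  have := abs_fwdDiff_iter_mul_le htpos h k g f (2 ^ (k ^ 2) * (Mg + Lg)) (2 ^ (k ^ 2) * (Mf + L))
    (by positivity) (by positivity)
    (abs_fwdDiff_iter_le_of_le htpos (by positivity) h k (fun x => (hg x).trans (by linarith))
      (fun x => (hgk x).trans (by rw [htk]; gcongr; linarith)))
    (abs_fwdDiff_iter_le_of_le htpos (by positivity) h k (fun x => (hf x).trans (by linarith))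
      (fun x => (hfk x).trans (by rw [htk]; gcongr; linarith))) x
  rwa [htk] at this

theorem continuous_mvEval {n : ℕ} (P : MvPolynomial (Fin n) ℝ) :
    Continuous fun x : EuclideanSpace ℝ (Fin n) => mvEval x P := by
  unfold mvEval
  exact P.continuous_eval.comp (by fun_prop)

theorem iterDiff_mvEval_eq_zero {n k : ℕ} (P : MvPolynomial (Fin n) ℝ) (hP : P.totalDegree < k)
    (h x : EuclideanSpace ℝ (Fin n)) : iterDiff h (fun y => mvEval y P) k x = 0 := by
  set q : Polynomial ℝ :=
    MvPolynomial.aeval (fun i => Polynomial.C (x i) + Polynomial.C (h i) * Polynomial.X) P with hq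
  have hdeg : q.natDegree < k := by
    refine lt_of_le_of_lt (MvPolynomial.aeval_natDegree_le P le_rfl _ (n := 1) fun i => ?_)
      (by simpa using hP)
    compute_degree
  have heval : ∀ t : ℝ, q.eval t = mvEval (x + t • h) P := by
    intro t
    rw [hq, mvEval, ← Polynomial.coe_evalRingHom, MvPolynomial.aeval_def, MvPolynomial.hom_eval₂]
    rw [MvPolynomial.eval, MvPolynomial.coe_eval₂Hom]
    congr 1
    · ext; simp
    · ext i; simp; ring
  have h0 := congrFun (Polynomial.fwdDiff_iter_eq_zero_of_degree_lt hdeg) 0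
  rw [fwdDiff_iter_eq_sum_shift] at h0
  rw [iterDiff_eq_iterate, fwdDiff_iter_eq_sum_shift]
  refine Eq.trans (Finset.sum_congr rfl fun j _ => ?_) h0
  rw [heval]
  simp only [zero_add, nsmul_eq_mul, mul_one, Nat.cast_smul_eq_nsmul]

theorem iterDiff_sub {n : ℕ} (h : EuclideanSpace ℝ (Fin n)) (f g : EuclideanSpace ℝ (Fin n) → ℝ)
    (k : ℕ) (x : EuclideanSpace ℝ (Fin n)) :
    iterDiff h (fun y => f y - g y) k x = iterDiff h f k x - iterDiff h g k x := by
  induction k generalizing x with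
  | zero => rfl
  | succ k ih => simp only [iterDiff, ih]; ring

/-- Coefficients expressing a value through the shifts by positive multiples, up to an iterated
difference of order `k`. -/
def shiftCoeff (k i : ℕ) : ℝ := -(-1) ^ k * ((-1) ^ (k - (i + 1)) * k.choose (i + 1))

theorem abs_shiftCoeff_le (k i : ℕ) : |shiftCoeff k i| ≤ 2 ^ k := by
  simp only [shiftCoeff, abs_mul, abs_neg, abs_pow, abs_one, one_pow, one_mul, Nat.abs_cast]
  exact_mod_cast Nat.choose_le_two_pow k (i + 1)

theorem eq_iterDiff_add_sum_shift {n : ℕ} (u : EuclideanSpace ℝ (Fin n) → ℝ) (k : ℕ)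
    (y h : EuclideanSpace ℝ (Fin n)) :
    u y = (-1) ^ k * iterDiff h u k y +
      ∑ i ∈ Finset.range k, shiftCoeff k i * u (y + ((i : ℝ) + 1) • h) := by
  rw [iterDiff_eq_iterate, fwdDiff_iter_eq_sum_shift, Finset.sum_range_succ']
  rw [mul_add, Finset.mul_sum, add_right_comm, ← Finset.sum_add_distrib, Finset.sum_eq_zero]
  · simp
    rw [← mul_assoc, ← pow_add, Even.neg_one_pow ⟨k, rfl⟩, one_mul]
  · intro i _
    have : y + ((i : ℝ) + 1) • h = y + (i + 1) • h := by
      rw [← Nat.cast_smul_eq_nsmul ℝ]; push_cast; rfl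
    rw [this]
    simp [shiftCoeff]
    ring

/-- Reproducing average of order `k` at scale `t` with weight `ψ`. -/
noncomputable def reproAvg {n : ℕ} (k : ℕ) (ψ : EuclideanSpace ℝ (Fin n) → ℝ) (t : ℝ)
    (u : EuclideanSpace ℝ (Fin n) → ℝ) (y : EuclideanSpace ℝ (Fin n)) : ℝ :=
  ∑ i ∈ Finset.range k, shiftCoeff k i * ∫ z, ψ z * u (y + (((i : ℝ) + 1) * t) • z)

/-- A smooth probability density supported in the unit ball. -/
structure IsUnitBump {n : ℕ} (ψ : EuclideanSpace ℝ (Fin n) → ℝ) : Prop where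
  contDiff : ∀ m : ℕ, ContDiff ℝ m ψ
  hasCompactSupport : HasCompactSupport ψ
  nonneg : ∀ z, 0 ≤ ψ z
  integral_eq_one : ∫ z, ψ z = 1
  eq_zero : ∀ z, 1 ≤ ‖z‖ → ψ z = 0

theorem exists_isUnitBump (n : ℕ) : ∃ ψ : EuclideanSpace ℝ (Fin n) → ℝ, IsUnitBump ψ := by
  let b : ContDiffBump (0 : EuclideanSpace ℝ (Fin n)) := ⟨1 / 2, 1, by norm_num, by norm_num⟩
  refine ⟨b.normed volume, fun m => b.contDiff_normed, b.hasCompactSupport_normed,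
    b.nonneg_normed, b.integral_normed, fun z hz => ?_⟩
  have : z ∉ Function.support (b.normed volume) := by
    rw [b.support_normed_eq]
    simpa [b] using hz
  simpa using this

namespace IsUnitBump

variable {n : ℕ} {ψ : EuclideanSpace ℝ (Fin n) → ℝ}

theorem continuous (hψ : IsUnitBump ψ) : Continuous ψ :=
  (hψ.contDiff 0).continuous

theorem integrable (hψ : IsUnitBump ψ) : Integrable ψ :=
  hψ.continuous.integrable_of_hasCompactSupport hψ.hasCompactSupport

theorem exists_le (hψ : IsUnitBump ψ) : ∃ C, 0 < C ∧ ∀ z, ψ z ≤ C := by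
  obtain ⟨C, hC⟩ := hψ.continuous.bounded_above_of_compact_support hψ.hasCompactSupport
  exact ⟨max C 1, by positivity, fun z => (le_abs_self _).trans ((hC z).trans (le_max_left _ _))⟩

theorem integrable_mul (hψ : IsUnitBump ψ) {w : EuclideanSpace ℝ (Fin n) → ℝ}
    (hw : LocallyIntegrable w) : Integrable fun z => ψ z * w z := by
  simpa using hw.integrable_smul_left_of_hasCompactSupport hψ.continuous hψ.hasCompactSupport

end IsUnitBump

theorem locallyIntegrable_comp_add_smul {n : ℕ} {u : EuclideanSpace ℝ (Fin n) → ℝ}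
    (hu : LocallyIntegrable u) (y : EuclideanSpace ℝ (Fin n)) {t : ℝ} (ht : t ≠ 0) :
    LocallyIntegrable fun z => u (y + t • z) := by
  rw [locallyIntegrable_iff] at hu ⊢
  intro K hK
  set K' := (fun z => y + t • z) '' K with hK'
  have hcK' : IsCompact K' := hK.image (by fun_prop)
  have h1 : Integrable (K'.indicator u) := (integrable_indicator_iff hcK'.measurableSet).2 (hu K' hcK')
  rw [← integrable_indicator_iff hK.measurableSet]
  refine ((h1.comp_add_left y).comp_smul ht).congr (Filter.Eventually.of_forall fun z => ?_)
  beta_reduce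
  have hmem : y + t • z ∈ K' ↔ z ∈ K := by
    rw [hK', Set.mem_image]
    refine ⟨?_, fun hz => ⟨z, hz, rfl⟩⟩
    rintro ⟨w, hw, hwz⟩
    rwa [← smul_right_injective _ ht (add_left_cancel hwz)]
  by_cases hz : z ∈ K
  · rw [Set.indicator_of_mem hz, Set.indicator_of_mem (hmem.2 hz)]
  · rw [Set.indicator_of_notMem hz, Set.indicator_of_notMem (mt hmem.1 hz)]

theorem reproAvg_sub {n k : ℕ} {ψ : EuclideanSpace ℝ (Fin n) → ℝ} (hψ : IsUnitBump ψ) {t : ℝ}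
    (ht : 0 < t) {u w : EuclideanSpace ℝ (Fin n) → ℝ} (hu : LocallyIntegrable u)
    (hw : LocallyIntegrable w) (y : EuclideanSpace ℝ (Fin n)) :
    reproAvg k ψ t (fun x => u x - w x) y = reproAvg k ψ t u y - reproAvg k ψ t w y := by
  unfold reproAvg
  rw [← Finset.sum_sub_distrib]
  refine Finset.sum_congr rfl fun i _ => ?_
  rw [← mul_sub, ← integral_sub]
  · simp only [mul_sub]
  · exact hψ.integrable_mul (locallyIntegrable_comp_add_smul hu y (by positivity))
  · exact hψ.integrable_mul (locallyIntegrable_comp_add_smul hw y (by positivity))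

theorem sub_reproAvg_eq {n k : ℕ} {ψ : EuclideanSpace ℝ (Fin n) → ℝ} (hψ : IsUnitBump ψ) {t : ℝ}
    (ht : 0 < t) {u : EuclideanSpace ℝ (Fin n) → ℝ} (hu : LocallyIntegrable u)
    (y : EuclideanSpace ℝ (Fin n)) :
    u y - reproAvg k ψ t u y = ∫ z, ψ z * ((-1) ^ k * iterDiff (t • z) u k y) := by
  have h1 : u y = ∫ z, ψ z * u y := by rw [integral_mul_const, hψ.integral_eq_one, one_mul]
  have h2 : reproAvg k ψ t u y
      = ∫ z, ∑ i ∈ Finset.range k, ψ z * (shiftCoeff k i * u (y + (((i : ℝ) + 1) * t) • z)) := by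
    rw [integral_finsetSum, reproAvg]
    · refine Finset.sum_congr rfl fun i _ => ?_
      rw [← integral_const_mul]
      congr 1; ext z; ring
    · intro i _
      exact hψ.integrable_mul
        ((locallyIntegrable_comp_add_smul hu y (by positivity)).smul (shiftCoeff k i))
  rw [h2]
  nth_rewrite 1 [h1]
  rw [← integral_sub (hψ.integrable.mul_const _)]
  · congr 1
    ext z
    have := eq_iterDiff_add_sum_shift u k y (t • z)
    nth_rewrite 1 [this]
    simp only [smul_smul, ← Finset.mul_sum]
    ring
  · refine integrable_finsetSum _ fun i _ => ?_
    exact hψ.integrable_mul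
        ((locallyIntegrable_comp_add_smul hu y (by positivity)).smul (shiftCoeff k i))

theorem reproAvg_mvEval {n k : ℕ} {ψ : EuclideanSpace ℝ (Fin n) → ℝ} (hψ : IsUnitBump ψ) {t : ℝ}
    (ht : 0 < t) (P : MvPolynomial (Fin n) ℝ) (hP : P.totalDegree < k)
    (y : EuclideanSpace ℝ (Fin n)) : reproAvg k ψ t (fun x => mvEval x P) y = mvEval y P := by
  have := sub_reproAvg_eq (k := k) hψ ht (continuous_mvEval P).locallyIntegrable y
  simp only [iterDiff_mvEval_eq_zero P hP, mul_zero, integral_zero] at this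
  linarith

theorem abs_sub_reproAvg_le {n k : ℕ} {ψ : EuclideanSpace ℝ (Fin n) → ℝ} (hψ : IsUnitBump ψ)
    {t β L : ℝ} (ht : 0 < t) (hβ : 0 ≤ β) (hL : 0 ≤ L) (hk : 0 < k)
    {u : EuclideanSpace ℝ (Fin n) → ℝ}
    (hu : LocallyIntegrable u) (hD : ∀ x h, h ≠ 0 → |iterDiff h u k x| ≤ L * ‖h‖ ^ β)
    (y : EuclideanSpace ℝ (Fin n)) :
    |u y - reproAvg k ψ t u y| ≤ L * t ^ β := by
  rw [sub_reproAvg_eq hψ ht hu]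
  have hzero : ∀ x, iterDiff (0 : EuclideanSpace ℝ (Fin n)) u k x = 0 := by
    intro x
    obtain ⟨m, rfl⟩ : ∃ m, k = m + 1 := ⟨k - 1, by omega⟩
    simp [iterDiff]
  have hb : ∀ z, ‖ψ z * ((-1) ^ k * iterDiff (t • z) u k y)‖ ≤ ψ z * (L * t ^ β) := by
    intro z
    rw [norm_mul, norm_mul, norm_pow, norm_neg, norm_one, one_pow, one_mul, Real.norm_eq_abs,
      Real.norm_eq_abs, abs_of_nonneg (hψ.nonneg z)]
    rcases lt_or_ge ‖z‖ 1 with hz | hz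
    · refine mul_le_mul_of_nonneg_left ?_ (hψ.nonneg z)
      rcases eq_or_ne z 0 with rfl | hz0
      · rw [smul_zero, hzero, abs_zero]; positivity
      · refine (hD y _ (smul_ne_zero ht.ne' hz0)).trans ?_
        rw [norm_smul, Real.norm_of_nonneg ht.le]
        gcongr
        nlinarith
    · simp [hψ.eq_zero z hz]
  calc _ ≤ ∫ z, ψ z * (L * t ^ β) :=
        norm_integral_le_of_norm_le (hψ.integrable.mul_const _) (Filter.Eventually.of_forall hb)
    _ = L * t ^ β := by rw [integral_mul_const, hψ.integral_eq_one, one_mul]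

theorem volume_ball_toReal {n : ℕ} (x : EuclideanSpace ℝ (Fin n)) {r : ℝ} (hr : 0 < r) :
    (volume (Metric.ball x r)).toReal
      = r ^ n * (volume (Metric.ball (0 : EuclideanSpace ℝ (Fin n)) 1)).toReal := by
  rw [Measure.addHaar_ball_of_pos _ _ hr, ENNReal.toReal_mul, finrank_euclideanSpace_fin,
    ENNReal.toReal_ofReal (by positivity)]

theorem volume_unitBall_toReal_pos (n : ℕ) :
    0 < (volume (Metric.ball (0 : EuclideanSpace ℝ (Fin n)) 1)).toReal :=
  ENNReal.toReal_pos (Metric.measure_ball_pos _ _ one_pos).ne' measure_ball_lt_top.ne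

theorem integral_PhiP_indicator {n : ℕ} (p lam : ℝ) (x : EuclideanSpace ℝ (Fin n)) (r : ℝ) :
    ∫ y, PhiP p (|(Metric.ball x r).indicator (fun _ => (1 : ℝ)) y| / lam)
      = (volume (Metric.ball x r)).toReal * PhiP p (1 / lam) := by
  have : (fun y => PhiP p (|(Metric.ball x r).indicator (fun _ => (1 : ℝ)) y| / lam))
      = (Metric.ball x r).indicator fun _ => PhiP p (1 / lam) := by
    ext y
    by_cases hy : y ∈ Metric.ball x r
    · simp [Set.indicator_of_mem hy]
    · simp [Set.indicator_of_notMem hy, PhiP]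
  rw [this, integral_indicator Metric.isOpen_ball.measurableSet]
  simp [Measure.real]

theorem PhiP_one_div {p lam : ℝ} (hlam : 0 < lam) : PhiP p (1 / lam) = 1 / (lam + lam ^ p) := by
  have h : (1 / lam) ^ (1 - p) = lam ^ p / lam := by
    rw [Real.div_rpow zero_le_one hlam.le, Real.one_rpow, Real.rpow_sub hlam, Real.rpow_one,
      one_div_div]
  have : 0 < lam ^ p := Real.rpow_pos_of_pos hlam p
  rw [PhiP, h]
  field_simp

theorem luxNorm_indicator_ball_eq {n : ℕ} (p : ℝ) (x : EuclideanSpace ℝ (Fin n)) (r : ℝ) :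
    luxNorm n p ((Metric.ball x r).indicator fun _ => (1 : ℝ))
      = sInf {lam : ℝ | 0 < lam ∧ (volume (Metric.ball x r)).toReal ≤ lam + lam ^ p} := by
  rw [luxNorm]
  congr 1
  ext lam
  simp only [Set.mem_ofPred_eq]
  refine and_congr_right fun hlam => ?_
  have : 0 < lam ^ p := Real.rpow_pos_of_pos hlam p
  rw [integral_PhiP_indicator, PhiP_one_div hlam, mul_one_div, div_le_one (by positivity)]

theorem luxNorm_indicator_ball_le {n : ℕ} {p : ℝ} (hp : 0 < p) (x : EuclideanSpace ℝ (Fin n))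
    {r : ℝ} (hr : 0 < r) :
    luxNorm n p ((Metric.ball x r).indicator fun _ => (1 : ℝ))
      ≤ (volume (Metric.ball x r)).toReal ^ (1 / p) := by
  have hv : 0 < (volume (Metric.ball x r)).toReal := by
    rw [volume_ball_toReal x hr]
    have := volume_unitBall_toReal_pos n
    positivity
  rw [luxNorm_indicator_ball_eq]
  have h1 : 0 < (volume (Metric.ball x r)).toReal ^ (1 / p) := Real.rpow_pos_of_pos hv _
  refine csInf_le ⟨0, fun lam h => h.1.le⟩ ⟨h1, ?_⟩
  rw [← Real.rpow_mul hv.le, one_div_mul_cancel hp.ne', Real.rpow_one]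
  linarith

theorem le_luxNorm_indicator_ball {n : ℕ} {p : ℝ}
    (x : EuclideanSpace ℝ (Fin n)) {r : ℝ} {b : ℝ}
    (hb : ∀ lam > 0, (volume (Metric.ball x r)).toReal ≤ lam + lam ^ p → b ≤ lam) :
    b ≤ luxNorm n p ((Metric.ball x r).indicator fun _ => (1 : ℝ)) := by
  rw [luxNorm_indicator_ball_eq]
  refine le_csInf ⟨(volume (Metric.ball x r)).toReal + 1, by positivity, ?_⟩ fun lam h =>
    hb lam h.1 h.2
  have : 0 ≤ ((volume (Metric.ball x r)).toReal + 1) ^ p := by positivity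
  linarith

theorem le_luxNorm_of_volume_lt_one {n : ℕ} {p : ℝ} (hp : p ∈ Set.Ioo (0 : ℝ) 1)
    (x : EuclideanSpace ℝ (Fin n)) {r : ℝ} (hv : (volume (Metric.ball x r)).toReal < 1) :
    (1 / 2) ^ (1 / p) * (volume (Metric.ball x r)).toReal ^ (1 / p)
      ≤ luxNorm n p ((Metric.ball x r).indicator fun _ => (1 : ℝ)) := by
  refine le_luxNorm_indicator_ball x fun lam hlam h => ?_
  have hp0 := hp.1
  set m := (volume (Metric.ball x r)).toReal
  have hm : 0 ≤ m := ENNReal.toReal_nonneg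
  rw [← Real.mul_rpow (by norm_num) hm]
  have h1 : 1 / 2 * m ≤ lam ^ p := by
    rcases le_total lam 1 with h1 | h1
    · have : lam ≤ lam ^ p := by
        simpa using Real.rpow_le_rpow_of_exponent_ge hlam h1 hp.2.le
      linarith
    · have : 1 ≤ lam ^ p := Real.one_le_rpow h1 hp0.le
      linarith
  calc (1 / 2 * m) ^ (1 / p) ≤ (lam ^ p) ^ (1 / p) := by gcongr
    _ = lam := by rw [← Real.rpow_mul hlam.le, mul_one_div_cancel hp0.ne', Real.rpow_one]

theorem le_luxNorm_of_one_le_volume {n : ℕ} {p : ℝ} (hp : p ∈ Set.Ioo (0 : ℝ) 1)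
    (x : EuclideanSpace ℝ (Fin n)) {r : ℝ} (hv : 1 ≤ (volume (Metric.ball x r)).toReal) :
    (1 / 2) ^ (1 / p) / 2 * (volume (Metric.ball x r)).toReal
      ≤ luxNorm n p ((Metric.ball x r).indicator fun _ => (1 : ℝ)) := by
  refine le_luxNorm_indicator_ball x fun lam hlam h => ?_
  have hp0 := hp.1
  set m := (volume (Metric.ball x r)).toReal
  have hc : ((1 : ℝ) / 2) ^ (1 / p) ≤ 1 := Real.rpow_le_one (by norm_num) (by norm_num) (by positivity)
  have hc0 : 0 < ((1 : ℝ) / 2) ^ (1 / p) := by positivity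
  rcases le_total lam 1 with h1 | h1
  · have h2 : lam ≤ lam ^ p := by
      simpa using Real.rpow_le_rpow_of_exponent_ge hlam h1 hp.2.le
    have h4 : lam ^ p ≤ 1 := Real.rpow_le_one hlam.le h1 hp0.le
    have h3 : ((1 : ℝ) / 2) ^ (1 / p) ≤ lam := calc
      ((1 : ℝ) / 2) ^ (1 / p) ≤ (lam ^ p) ^ (1 / p) := by gcongr; linarith
      _ = lam := by rw [← Real.rpow_mul hlam.le, mul_one_div_cancel hp0.ne', Real.rpow_one]
    nlinarith
  · have : lam ^ p ≤ lam := by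
      simpa using Real.rpow_le_rpow_of_exponent_le h1 hp.2.le
    nlinarith

theorem integrableOn_ball_of_continuous {n : ℕ} {f : EuclideanSpace ℝ (Fin n) → ℝ}
    (hf : Continuous f) (x : EuclideanSpace ℝ (Fin n)) (r : ℝ) :
    IntegrableOn f (Metric.ball x r) :=
  (hf.continuousOn.integrableOn_compact (isCompact_closedBall x r)).mono_set
    Metric.ball_subset_closedBall

theorem integrableOn_ball_mul_continuous {n : ℕ} {g f : EuclideanSpace ℝ (Fin n) → ℝ}
    (hg : LocallyIntegrable g) (hf : Continuous f) (x : EuclideanSpace ℝ (Fin n)) (r : ℝ) :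
    IntegrableOn (fun y => g y * f y) (Metric.ball x r) :=
  ((hg.integrableOn_isCompact (isCompact_closedBall x r)).mul_continuousOn hf.continuousOn
    (isCompact_closedBall x r)).mono_set Metric.ball_subset_closedBall

theorem eq_zero_of_integral_ball_sq_eq_zero {n : ℕ} (x : EuclideanSpace ℝ (Fin n)) {r : ℝ}
    (hr : 0 < r) (P : MvPolynomial (Fin n) ℝ)
    (hP : ∫ y in Metric.ball x r, mvEval y P * mvEval y P = 0) : P = 0 := by
  have hc : Continuous fun y : EuclideanSpace ℝ (Fin n) => mvEval y P * mvEval y P :=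
    (continuous_mvEval P).mul (continuous_mvEval P)
  rw [setIntegral_eq_zero_iff_of_nonneg_ae (Filter.Eventually.of_forall fun y => mul_self_nonneg _)
    (integrableOn_ball_of_continuous hc x r)] at hP
  have hz : Set.EqOn (fun y : EuclideanSpace ℝ (Fin n) => mvEval y P * mvEval y P) 0
      (Metric.ball x r) :=
    Measure.eqOn_open_of_ae_eq hP Metric.isOpen_ball hc.continuousOn continuousOn_const
  have hopen : IsOpen ((WithLp.toLp 2 : (Fin n → ℝ) → EuclideanSpace ℝ (Fin n)) ⁻¹'
      Metric.ball x r) := Metric.isOpen_ball.preimage (PiLp.continuous_toLp 2 _)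
  obtain ⟨ε, hε, hsub⟩ := Metric.isOpen_iff.1 hopen (fun i => x i) (by simpa using hr)
  refine MvPolynomial.funext_set (fun i => Metric.ball (x i) ε) (fun i => ?_) fun y hy => ?_
  · rw [Real.ball_eq_Ioo]; exact Set.Ioo_infinite (by linarith)
  · have hy' : y ∈ Metric.ball (fun i => x i) ε := by
      rw [ball_pi _ hε]; exact hy
    have := hz (hsub hy')
    simpa [mvEval] using this

/-- Existence of minimizing polynomials on balls. -/
theorem exists_minimizing_polynomial {n : ℕ} (s : ℕ) {g : EuclideanSpace ℝ (Fin n) → ℝ}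
    (hg : LocallyIntegrable g) (x : EuclideanSpace ℝ (Fin n)) {r : ℝ} (hr : 0 < r) :
    ∃ P : MvPolynomial (Fin n) ℝ, P.totalDegree ≤ s ∧
      ∀ R : MvPolynomial (Fin n) ℝ, R.totalDegree ≤ s →
        ∫ y in Metric.ball x r, (g y - mvEval y P) * mvEval y R = 0 := by
  let V := MvPolynomial.restrictTotalDegree (Fin n) ℝ s
  have h_int : ∀ P R : MvPolynomial (Fin n) ℝ,
      IntegrableOn (fun y => mvEval y P * mvEval y R) (Metric.ball x r) := fun P R =>
    integrableOn_ball_of_continuous ((continuous_mvEval P).mul (continuous_mvEval R)) x r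
  have hintg : ∀ R : MvPolynomial (Fin n) ℝ,
      IntegrableOn (fun y => g y * mvEval y R) (Metric.ball x r) := fun R =>
    integrableOn_ball_mul_continuous hg (continuous_mvEval R) x r
  have hadd : ∀ (y : EuclideanSpace ℝ (Fin n)) (P R : MvPolynomial (Fin n) ℝ),
      mvEval y (P + R) = mvEval y P + mvEval y R := fun y P R => by simp [mvEval]
  have hsmul : ∀ (y : EuclideanSpace ℝ (Fin n)) (c : ℝ) (P : MvPolynomial (Fin n) ℝ),
      mvEval y (c • P) = c * mvEval y P := fun y c P => by simp [mvEval]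
  let G : V →ₗ[ℝ] Module.Dual ℝ V := LinearMap.mk₂ ℝ
    (fun P R => ∫ y in Metric.ball x r, mvEval y P.1 * mvEval y R.1)
    (fun P Q R => by
      simp only [Submodule.coe_add, hadd, add_mul]
      exact integral_add (h_int _ _) (h_int _ _))
    (fun c P R => by
      simp only [Submodule.coe_smul, hsmul, mul_assoc, smul_eq_mul]
      exact integral_const_mul _ _)
    (fun P Q R => by
      simp only [Submodule.coe_add, hadd, mul_add]
      exact integral_add (h_int _ _) (h_int _ _))
    (fun c P R => by
      simp only [Submodule.coe_smul, hsmul, mul_left_comm, smul_eq_mul]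
      exact integral_const_mul _ _)
  let ℓ : Module.Dual ℝ V :=
    { toFun := fun R => ∫ y in Metric.ball x r, g y * mvEval y R.1
      map_add' := fun P Q => by
        simp only [Submodule.coe_add, hadd, mul_add]
        exact integral_add (hintg _) (hintg _)
      map_smul' := fun c P => by
        simp only [Submodule.coe_smul, hsmul, mul_left_comm, smul_eq_mul, RingHom.id_apply]
        exact integral_const_mul _ _ }
  have hinj : Function.Injective G := by
    rw [injective_iff_map_eq_zero]
    intro P hP
    exact Subtype.ext (eq_zero_of_integral_ball_sq_eq_zero x hr P.1 (LinearMap.congr_fun hP P))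
  have hsurj := (LinearMap.injective_iff_surjective_of_finrank_eq_finrank
    (Subspace.dual_finrank_eq (K := ℝ) (V := V)).symm).1 hinj
  obtain ⟨P, hP⟩ := hsurj ℓ
  refine ⟨P.1, (MvPolynomial.mem_restrictTotalDegree _ _ _).1 P.2, fun R hR => ?_⟩
  have h1 : ∫ y in Metric.ball x r, mvEval y P.1 * mvEval y R
      = ∫ y in Metric.ball x r, g y * mvEval y R :=
    LinearMap.congr_fun hP ⟨R, (MvPolynomial.mem_restrictTotalDegree _ _ _).2 hR⟩
  simp only [sub_mul]
  rw [integral_sub (hintg R) (h_int _ _), h1, sub_self]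

theorem exists_abs_reproAvg_le {n : ℕ} (k : ℕ) {ψ : EuclideanSpace ℝ (Fin n) → ℝ}
    (hψ : IsUnitBump ψ) :
    ∃ C, 0 < C ∧ ∀ (t : ℝ) (w : EuclideanSpace ℝ (Fin n) → ℝ) (y x₀ : EuclideanSpace ℝ (Fin n))
      (ρ : ℝ), 0 < t → LocallyIntegrable w → Metric.ball y (k * t) ⊆ Metric.ball x₀ ρ →
      |reproAvg k ψ t w y| ≤ C * (t ^ n)⁻¹ * ∫ x in Metric.ball x₀ ρ, |w x| := by
  obtain ⟨B, hB, hψB⟩ := hψ.exists_le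
  refine ⟨(k * 2 ^ k + 1) * B, by positivity, fun t w y x₀ ρ ht hw hsub => ?_⟩
  set F : EuclideanSpace ℝ (Fin n) → ℝ := (Metric.ball x₀ ρ).indicator fun x => |w x| with hF
  have hwi : IntegrableOn (fun x => |w x|) (Metric.ball x₀ ρ) :=
    ((hw.integrableOn_isCompact (isCompact_closedBall x₀ ρ)).mono_set
      Metric.ball_subset_closedBall).abs
  have hFi : Integrable F := (integrable_indicator_iff Metric.isOpen_ball.measurableSet).2 hwi
  have hF0 : ∀ x, 0 ≤ F x := fun x => Set.indicator_nonneg (fun _ _ => abs_nonneg _) x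
  have hI : ∫ x, F x = ∫ x in Metric.ball x₀ ρ, |w x| :=
    integral_indicator Metric.isOpen_ball.measurableSet
  have hI0 : 0 ≤ ∫ x, F x := integral_nonneg hF0
  have key : ∀ i ∈ Finset.range k,
      |shiftCoeff k i * ∫ z, ψ z * w (y + (((i : ℝ) + 1) * t) • z)| ≤
        2 ^ k * (B * ((t ^ n)⁻¹ * ∫ x, F x)) := by
    intro i hi
    have hik : (i : ℝ) + 1 ≤ k := by exact_mod_cast Finset.mem_range.1 hi
    set τ : ℝ := ((i : ℝ) + 1) * t with hτ
    have hi0 : (0 : ℝ) ≤ i := i.cast_nonneg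
    have hτt : t ≤ τ := by nlinarith
    have hτ0 : 0 < τ := ht.trans_le hτt
    have hτk : τ ≤ k * t := by rw [hτ]; gcongr
    have hpt : ∀ z, ‖ψ z * w (y + τ • z)‖ ≤ B * F (y + τ • z) := by
      intro z
      rcases lt_or_ge ‖z‖ 1 with hz | hz
      · have hmem : y + τ • z ∈ Metric.ball x₀ ρ := by
          refine hsub ?_
          rw [Metric.mem_ball, dist_eq_norm, add_sub_cancel_left, norm_smul,
            Real.norm_of_nonneg hτ0.le]
          nlinarith
        rw [hF, Set.indicator_of_mem hmem, norm_mul, Real.norm_of_nonneg (hψ.nonneg z),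
          Real.norm_eq_abs]
        gcongr
        exact hψB z
      · rw [hψ.eq_zero z hz, zero_mul, norm_zero]
        exact mul_nonneg hB.le (hF0 _)
    have hFi' : Integrable fun z => F (y + τ • z) := (hFi.comp_add_left y).comp_smul hτ0.ne'
    have hval : ∫ z, F (y + τ • z) = (τ ^ n)⁻¹ * ∫ x, F x := by
      rw [Measure.integral_comp_smul volume (fun x => F (y + x)) τ, integral_add_left_eq_self,
        finrank_euclideanSpace, Fintype.card_fin, abs_of_pos (by positivity), smul_eq_mul]
    rw [abs_mul]
    refine mul_le_mul (abs_shiftCoeff_le k i) ?_ (abs_nonneg _) (by positivity)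
    calc _ ≤ ∫ z, B * F (y + τ • z) :=
          norm_integral_le_of_norm_le (hFi'.const_mul B) (Filter.Eventually.of_forall hpt)
      _ = B * ((τ ^ n)⁻¹ * ∫ x, F x) := by rw [integral_const_mul, hval]
      _ ≤ _ := by gcongr
  calc |reproAvg k ψ t w y| ≤ ∑ i ∈ Finset.range k, 2 ^ k * (B * ((t ^ n)⁻¹ * ∫ x, F x)) :=
        (Finset.abs_sum_le_sum_abs _ _).trans (Finset.sum_le_sum key)
    _ = (k * 2 ^ k) * B * (t ^ n)⁻¹ * ∫ x, F x := by
        rw [Finset.sum_const, Finset.card_range, nsmul_eq_mul]; ring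
    _ ≤ _ := by rw [hI]; rw [hI] at hI0; gcongr; linarith

theorem abs_iterDiff_le_of_abs_le {n k : ℕ} {h x : EuclideanSpace ℝ (Fin n)}
    {u : EuclideanSpace ℝ (Fin n) → ℝ} {A : ℝ} (hu : ∀ j ≤ k, |u (x + j • h)| ≤ A) :
    |iterDiff h u k x| ≤ 2 ^ k * A := by
  induction k generalizing x with
  | zero => simpa [iterDiff] using hu 0 le_rfl
  | succ k ih =>
    have h1 := ih (x := x) fun j hj => hu j (by omega)
    have h2 := ih (x := x + h) fun j hj => by
      rw [add_assoc, ← succ_nsmul']; exact hu (j + 1) (by omega)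
    calc |iterDiff h u (k + 1) x| ≤ |iterDiff h u k (x + h)| + |iterDiff h u k x| := abs_sub _ _
      _ ≤ 2 ^ k * A + 2 ^ k * A := add_le_add h2 h1
      _ = _ := by ring

/-- `u` is approximated at scale `t` on every ball of radius `k t`, up to `c t ^ β`, by polynomials
of degree less than `k`, for `t ≤ T`. -/
def PolyApprox {n : ℕ} (k : ℕ) (β T c : ℝ) (u : EuclideanSpace ℝ (Fin n) → ℝ) : Prop :=
  ∀ t, 0 < t → t ≤ T → ∀ x₀, ∃ P : MvPolynomial (Fin n) ℝ, P.totalDegree < k ∧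
    ∀ y, dist y x₀ ≤ k * t → |u y - mvEval y P| ≤ c * t ^ β

theorem PolyApprox.continuous {n k : ℕ} {β T c : ℝ} {u : EuclideanSpace ℝ (Fin n) → ℝ}
    (hu : PolyApprox k β T c u) (hT : 0 < T) (hβ : 0 < β) (hk : 0 < k) : Continuous u := by
  refine continuous_of_locally_uniform_approx_of_continuousAt fun x U hU => ?_
  obtain ⟨ε, hε, hεU⟩ := Metric.mem_uniformity_dist.1 hU
  have hlim : Filter.Tendsto (fun t : ℝ => c * t ^ β) (nhdsWithin 0 (Set.Ioi 0)) (nhds 0) := by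
    have : Filter.Tendsto (fun t : ℝ => c * t ^ β) (nhds 0) (nhds (c * 0 ^ β)) :=
      ((Real.continuousAt_rpow_const 0 β (Or.inr hβ.le)).tendsto).const_mul c
    rw [Real.zero_rpow hβ.ne', mul_zero] at this
    exact this.mono_left nhdsWithin_le_nhds
  have h1 := hlim.eventually (gt_mem_nhds hε)
  have h2 : ∀ᶠ t in nhdsWithin (0 : ℝ) (Set.Ioi 0), t ≤ T :=
    Filter.Eventually.filter_mono nhdsWithin_le_nhds (eventually_le_nhds hT)
  obtain ⟨t, ⟨ht1, ht2⟩, ht0⟩ := ((h1.and h2).and self_mem_nhdsWithin).exists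
  have ht0 : 0 < t := ht0
  obtain ⟨P, -, hP⟩ := hu t ht0 ht2 x
  refine ⟨Metric.closedBall x (k * t), Metric.closedBall_mem_nhds x (by positivity),
    fun y => mvEval y P, (continuous_mvEval P).continuousAt, fun y hy => hεU ?_⟩
  rw [Real.dist_eq]
  exact (hP y hy).trans_lt ht1

theorem PolyApprox.abs_iterDiff_le {n k : ℕ} {β T c M : ℝ} {u : EuclideanSpace ℝ (Fin n) → ℝ}
    (hu : PolyApprox k β T c u) (hT : 0 < T) (hβ : 0 < β) (hc : 0 ≤ c) (hM : ∀ x, |u x| ≤ M)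
    (x h : EuclideanSpace ℝ (Fin n)) (hh : h ≠ 0) :
    |iterDiff h u k x| ≤ 2 ^ k * (c + M / T ^ β) * ‖h‖ ^ β := by
  have hM0 : 0 ≤ M := (abs_nonneg _).trans (hM 0)
  have hh0 : 0 < ‖h‖ := norm_pos_iff.2 hh
  rcases le_or_gt ‖h‖ T with hle | hgt
  · obtain ⟨P, hPk, hP⟩ := hu ‖h‖ hh0 hle x
    have h1 : |iterDiff h (fun y => u y - mvEval y P) k x| ≤ 2 ^ k * (c * ‖h‖ ^ β) := by
      refine abs_iterDiff_le_of_abs_le fun j hj => hP _ ?_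
      rw [dist_eq_norm, add_sub_cancel_left, ← Nat.cast_smul_eq_nsmul ℝ, norm_smul,
        Real.norm_natCast]
      gcongr
    rw [iterDiff_sub, iterDiff_mvEval_eq_zero P hPk, sub_zero] at h1
    refine h1.trans ?_
    rw [← mul_assoc]
    gcongr
    exact le_add_of_nonneg_right (by positivity)
  · have h1 : |iterDiff h u k x| ≤ 2 ^ k * M := abs_iterDiff_le_of_abs_le fun j _ => hM _
    refine h1.trans ?_
    rw [mul_assoc]
    gcongr
    have h2 : 1 ≤ ‖h‖ ^ β / T ^ β := by
      rw [one_le_div (by positivity)]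
      exact Real.rpow_le_rpow hT.le hgt.le hβ.le
    calc M = M * 1 := (mul_one M).symm
      _ ≤ M * (‖h‖ ^ β / T ^ β) := by gcongr
      _ ≤ c * ‖h‖ ^ β + M * (‖h‖ ^ β / T ^ β) := le_add_of_nonneg_left (by positivity)
      _ = _ := by ring

theorem exists_limit_polyApprox {n k : ℕ} {β T c : ℝ} (hβ : 0 < β) (hT : 0 < T) (hc : 0 ≤ c)
    {A : ℝ → EuclideanSpace ℝ (Fin n) → ℝ}
    (hA : ∀ t, 0 < t → t ≤ T → ∀ x₀, ∃ P : MvPolynomial (Fin n) ℝ, P.totalDegree < k ∧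
      ∀ τ, t / 2 ≤ τ → τ ≤ t → ∀ y, dist y x₀ ≤ k * t → |A τ y - mvEval y P| ≤ c * t ^ β) :
    ∃ u : EuclideanSpace ℝ (Fin n) → ℝ,
      (∀ y, Filter.Tendsto (fun i : ℕ => A (T * (1 / 2) ^ i) y) Filter.atTop (nhds (u y))) ∧
      PolyApprox k β T (c * (1 + 2 / (1 - (1 / 2) ^ β))) u := by
  set q : ℝ := (1 / 2) ^ β with hq
  have hq1 : q < 1 := Real.rpow_lt_one (by norm_num) (by norm_num) hβ
  have hti : ∀ i : ℕ, 0 < T * (1 / 2) ^ i := fun i => by positivity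
  have htT : ∀ i : ℕ, T * (1 / 2) ^ i ≤ T := fun i =>
    mul_le_of_le_one_right hT.le (pow_le_one₀ (by norm_num) (by norm_num))
  have hpow : ∀ i : ℕ, (T * (1 / 2) ^ i) ^ β = T ^ β * q ^ i := by
    intro i
    rw [Real.mul_rpow hT.le (by positivity), hq, ← Real.rpow_natCast, ← Real.rpow_mul (by norm_num),
      ← Real.rpow_natCast, ← Real.rpow_mul (by norm_num), mul_comm β]
  have hstep : ∀ y (i : ℕ), dist (A (T * (1 / 2) ^ i) y) (A (T * (1 / 2) ^ (i + 1)) y) ≤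
      2 * c * T ^ β * q ^ i := by
    intro y i
    obtain ⟨P, -, hP⟩ := hA _ (hti i) (htT i) y
    have hd : dist y y ≤ k * (T * (1 / 2) ^ i) := by
      rw [dist_self]; have := hti i; positivity
    have hi := hti i
    have e : T * (1 / 2 : ℝ) ^ (i + 1) = T * (1 / 2) ^ i / 2 := by ring
    have h1 := hP _ (by linarith) le_rfl y hd
    have h2 := hP (T * (1 / 2) ^ (i + 1)) (by rw [e]) (by rw [e]; linarith) y hd
    rw [hpow] at h1 h2
    rw [Real.dist_eq]
    rw [abs_le] at h1 h2 ⊢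
    constructor <;> linarith [h1.1, h1.2, h2.1, h2.2]
  have hlim : ∀ y, ∃ a, Filter.Tendsto (fun i : ℕ => A (T * (1 / 2) ^ i) y) Filter.atTop (nhds a) :=
    fun y => cauchySeq_tendsto_of_complete (cauchySeq_of_le_geometric q _ hq1 (hstep y))
  choose u hu using hlim
  refine ⟨u, hu, fun t ht htT' x₀ => ?_⟩
  obtain ⟨P, hPk, hP⟩ := hA t ht htT' x₀
  refine ⟨P, hPk, fun y hy => ?_⟩
  obtain ⟨i, hi1, hi2⟩ := exists_nat_pow_near_of_lt_one (x := t / T) (y := (1 / 2 : ℝ))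
    (by positivity) ((div_le_one hT).2 htT') (by norm_num) (by norm_num)
  rw [lt_div_iff₀ hT] at hi1
  rw [div_le_iff₀ hT] at hi2
  have e : T * (1 / 2 : ℝ) ^ (i + 1) = (1 / 2) ^ i * T / 2 := by ring
  have h1 := hP (T * (1 / 2) ^ (i + 1)) (by rw [e]; linarith) (by linarith) y hy
  have h2 := dist_le_of_le_geometric_of_tendsto q _ hq1 (hstep y) (hu y) (i + 1)
  rw [mul_assoc, ← hpow, Real.dist_eq] at h2
  have h3 : 2 * c * (T * (1 / 2) ^ (i + 1)) ^ β / (1 - q) ≤ 2 * c * t ^ β / (1 - q) := by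
    have := hti (i + 1)
    have : 0 < 1 - q := by linarith
    gcongr
    linarith
  have h4 : c * (1 + 2 / (1 - q)) * t ^ β = c * t ^ β + 2 * c * t ^ β / (1 - q) := by ring
  rw [h4]
  have h5 := h2.trans h3
  rw [abs_le] at h1 h5 ⊢
  constructor <;> linarith [h1.1, h1.2, h5.1, h5.2]

theorem exists_reproAvg_approx {n : ℕ} (k : ℕ) {ψ : EuclideanSpace ℝ (Fin n) → ℝ}
    (hψ : IsUnitBump ψ) (hk : 0 < k) (β : ℝ) :
    ∃ C, 0 < C ∧ ∀ (R H : ℝ) (g : EuclideanSpace ℝ (Fin n) → ℝ), 0 ≤ H → LocallyIntegrable g →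
      (∀ x₀ r, 0 < r → r < R → ∃ P : MvPolynomial (Fin n) ℝ, P.totalDegree < k ∧
        ∫ x in Metric.ball x₀ r, |g x - mvEval x P| ≤ H * (r ^ n * r ^ β)) →
      ∀ t, 0 < t → 2 * k * t < R → ∀ x₀, ∃ P : MvPolynomial (Fin n) ℝ, P.totalDegree < k ∧
        ∀ τ, t / 2 ≤ τ → τ ≤ t → ∀ y, dist y x₀ ≤ k * t →
          |reproAvg k ψ τ g y - mvEval y P| ≤ C * H * t ^ β := by
  obtain ⟨C, hC, hCb⟩ := exists_abs_reproAvg_le k hψ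
  have hk0 : (0 : ℝ) < k := by exact_mod_cast hk
  refine ⟨C * (4 * k) ^ n * (2 * k) ^ β, by positivity, fun R H g hH hg hosc t ht htR x₀ => ?_⟩
  obtain ⟨P, hPk, hP⟩ := hosc x₀ (2 * k * t) (by positivity) htR
  refine ⟨P, hPk, fun τ hτ1 hτ2 y hy => ?_⟩
  have hτ : 0 < τ := by linarith
  rw [← reproAvg_mvEval hψ hτ P hPk y,
    ← reproAvg_sub hψ hτ hg (continuous_mvEval P).locallyIntegrable]
  have hsub : Metric.ball y (k * τ) ⊆ Metric.ball x₀ (2 * k * t) := by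
    refine Metric.ball_subset_ball' ?_
    nlinarith
  refine (hCb τ _ y x₀ _ hτ (hg.sub (continuous_mvEval P).locallyIntegrable) hsub).trans ?_
  calc _ ≤ C * ((t / 2) ^ n)⁻¹ * (H * ((2 * k * t) ^ n * (2 * k * t) ^ β)) := by
        gcongr
        exact hP
    _ = _ := by
        rw [Real.mul_rpow (by positivity) ht.le, show 2 * k * t = (4 * k) * (t / 2) by ring,
          mul_pow (4 * (k : ℝ))]
        field_simp

theorem ae_tendsto_reproAvg {n k : ℕ} {ψ : EuclideanSpace ℝ (Fin n) → ℝ} (hψ : IsUnitBump ψ)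
    (hk : 0 < k) {g : EuclideanSpace ℝ (Fin n) → ℝ} (hg : LocallyIntegrable g) {T : ℝ}
    (hT : 0 < T) :
    ∀ᵐ y, Filter.Tendsto (fun i : ℕ => reproAvg k ψ (T * (1 / 2) ^ i) g y) Filter.atTop
      (nhds (g y)) := by
  obtain ⟨C, hC, hCb⟩ := exists_abs_reproAvg_le k hψ
  have hk0 : (0 : ℝ) < k := by exact_mod_cast hk
  filter_upwards [IsUnifLocDoublingMeasure.ae_tendsto_average_norm_sub volume hg 1] with y hy
  have hti : ∀ i : ℕ, 0 < T * (1 / 2) ^ i := fun i => by positivity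
  have hlim : Filter.Tendsto (fun i : ℕ => (k : ℝ) * (T * (1 / 2) ^ i)) Filter.atTop
      (nhdsWithin 0 (Set.Ioi 0)) := by
    refine tendsto_nhdsWithin_iff.2 ⟨?_, Filter.Eventually.of_forall fun i => ?_⟩
    · have := ((tendsto_pow_atTop_nhds_zero_of_lt_one (r := (1 / 2 : ℝ)) (by norm_num)
        (by norm_num)).const_mul T).const_mul (k : ℝ)
      simpa using this
    · have := hti i
      exact Set.mem_Ioi.2 (by positivity)
  have h1 := hy (fun _ => y) _ hlim (Filter.Eventually.of_forall fun i => by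
    have := hti i
    refine Metric.mem_closedBall_self (by positivity))
  rw [tendsto_iff_dist_tendsto_zero]
  set v := (volume (Metric.ball (0 : EuclideanSpace ℝ (Fin n)) 1)).toReal with hv
  have h2 := h1.const_mul (C * ((k : ℝ) ^ n * v))
  rw [mul_zero] at h2
  refine squeeze_zero (fun _ => dist_nonneg) (fun i => ?_) h2
  have ht := hti i
  set t := T * (1 / 2 : ℝ) ^ i with ht'
  have hconst : reproAvg k ψ t (fun _ => g y) y = g y := by
    have := reproAvg_mvEval hψ ht (MvPolynomial.C (g y)) (k := k) (by simpa using hk) y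
    simpa [mvEval] using this
  have hci : LocallyIntegrable (fun _ : EuclideanSpace ℝ (Fin n) => g y) :=
    continuous_const.locallyIntegrable
  have hdist : dist (reproAvg k ψ t g y) (g y) = |reproAvg k ψ t (fun x => g x - g y) y| := by
    rw [reproAvg_sub hψ ht hg hci, hconst, Real.dist_eq]
  rw [hdist]
  refine (hCb t _ y y (k * t) ht (hg.sub hci) subset_rfl).trans ?_
  have hvol : volume.real (Metric.closedBall y (k * t)) = (k * t) ^ n * v := by
    have hkt : 0 ≤ k * t := by positivity
    rw [Measure.real, Measure.addHaar_closedBall volume y hkt, ENNReal.toReal_mul,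
      finrank_euclideanSpace, Fintype.card_fin, ENNReal.toReal_ofReal (by positivity)]
  have hv0 : 0 < v := volume_unitBall_toReal_pos n
  rw [setAverage_eq, hvol, smul_eq_mul]
  have hle : ∫ x in Metric.ball y (k * t), |g x - g y| ≤
      ∫ x in Metric.closedBall y (k * t), ‖g x - g y‖ := by
    refine setIntegral_mono_set ?_ (Filter.Eventually.of_forall fun x => abs_nonneg _)
      (Metric.ball_subset_closedBall.eventuallyLE)
    exact (((hg.sub hci).integrableOn_isCompact (isCompact_closedBall y _)).norm)
  calc _ ≤ C * (t ^ n)⁻¹ * ∫ x in Metric.closedBall y (k * t), ‖g x - g y‖ := by gcongr; exact hle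
    _ = _ := by rw [mul_pow (k : ℝ) t]; clear_value t; field_simp

theorem abs_le_of_ae_abs_le {n : ℕ} {u : EuclideanSpace ℝ (Fin n) → ℝ} {M : ℝ}
    (hu : Continuous u) (hM : ∀ᵐ x, |u x| ≤ M) (x : EuclideanSpace ℝ (Fin n)) : |u x| ≤ M := by
  have hc : IsClosed {x | |u x| ≤ M} := isClosed_le hu.abs continuous_const
  have hd : Dense {x | |u x| ≤ M} := Measure.dense_of_ae hM
  have := hc.closure_eq ▸ hd x
  exact this

/-- Functions with small oscillation against polynomials on small balls are Lipschitz. -/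
theorem exists_lipschitz_representative (n k : ℕ) (hk : 0 < k) {β R : ℝ} (hβ : 0 < β)
    (hR : 0 < R) :
    ∃ C, 0 < C ∧ ∀ (M H : ℝ) (g : EuclideanSpace ℝ (Fin n) → ℝ), 0 ≤ H → LocallyIntegrable g →
      (∀ᵐ x, |g x| ≤ M) →
      (∀ x₀ r, 0 < r → r < R → ∃ P : MvPolynomial (Fin n) ℝ, P.totalDegree < k ∧
        ∫ x in Metric.ball x₀ r, |g x - mvEval x P| ≤ H * (r ^ n * r ^ β)) →
      ∃ u : EuclideanSpace ℝ (Fin n) → ℝ, Continuous u ∧ (∀ᵐ x, g x = u x) ∧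
        (∀ x, |u x| ≤ M) ∧ ∀ x h, h ≠ 0 → |iterDiff h u k x| ≤ C * (M + H) * ‖h‖ ^ β := by
  obtain ⟨ψ, hψ⟩ := exists_isUnitBump n
  obtain ⟨C, hC, hCb⟩ := exists_reproAvg_approx k hψ hk β
  have hk0 : (0 : ℝ) < k := by exact_mod_cast hk
  obtain ⟨T, hT, hTR⟩ : ∃ T : ℝ, 0 < T ∧ 2 * k * T < R := by
    refine ⟨R / (4 * k), by positivity, ?_⟩
    field_simp
    linarith
  have hq1 : (1 / 2 : ℝ) ^ β < 1 := Real.rpow_lt_one (by norm_num) (by norm_num) hβ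
  set d := 1 + 2 / (1 - (1 / 2 : ℝ) ^ β) with hd
  have hd0 : 0 < d := by have : 0 < 1 - (1 / 2 : ℝ) ^ β := by linarith
                         positivity
  refine ⟨2 ^ k * (C * d + 1 / T ^ β), by positivity, fun M H g hH hg hM hosc => ?_⟩
  obtain ⟨u, hlim, hu⟩ := exists_limit_polyApprox hβ hT (c := C * H) (by positivity)
    (A := fun t y => reproAvg k ψ t g y) fun t ht htT =>
      hCb R H g hH hg hosc t ht (lt_of_le_of_lt (by gcongr) hTR)
  have huc := hu.continuous hT hβ hk
  have hae : ∀ᵐ x, g x = u x := by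
    filter_upwards [ae_tendsto_reproAvg hψ hk hg hT] with y hy
    exact tendsto_nhds_unique hy (hlim y)
  have huM : ∀ x, |u x| ≤ M := abs_le_of_ae_abs_le huc (by
    filter_upwards [hae, hM] with x hx hx'
    rwa [← hx])
  refine ⟨u, huc, hae, huM, fun x h hh => ?_⟩
  refine (hu.abs_iterDiff_le hT hβ (by positivity) huM x h hh).trans ?_
  have hM0 : 0 ≤ M := (abs_nonneg _).trans (huM 0)
  refine mul_le_mul_of_nonneg_right ?_ (Real.rpow_nonneg (norm_nonneg h) β)
  rw [mul_assoc (2 ^ k)]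
  refine mul_le_mul_of_nonneg_left ?_ (by positivity : (0 : ℝ) ≤ 2 ^ k)
  have h2 : 0 ≤ C * d * M := by positivity
  have h3 : 0 ≤ 1 / T ^ β * H := by positivity
  have h4 : M / T ^ β = 1 / T ^ β * M := by ring
  rw [h4, ← hd]
  linarith

theorem rpow_smoothness_pos {n : ℕ} (hn : 0 < n) {p : ℝ} (hp : p ∈ Set.Ioo (0 : ℝ) 1) :
    0 < (n : ℝ) * (1 / p - 1) := by
  have h1 : 1 < 1 / p := (one_lt_div hp.1).2 hp.2
  have hn' : (0 : ℝ) < n := by exact_mod_cast hn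
  exact mul_pos hn' (by linarith)

theorem volume_ball_rpow {n : ℕ} (p : ℝ) (x : EuclideanSpace ℝ (Fin n)) {r : ℝ}
    (hr : 0 < r) :
    (volume (Metric.ball x r)).toReal ^ (1 / p) =
      (volume (Metric.ball (0 : EuclideanSpace ℝ (Fin n)) 1)).toReal ^ (1 / p) *
        (r ^ n * r ^ ((n : ℝ) * (1 / p - 1))) := by
  rw [volume_ball_toReal x hr, Real.mul_rpow (by positivity) ENNReal.toReal_nonneg,
    ← Real.rpow_natCast, ← Real.rpow_mul hr.le, ← Real.rpow_add hr, mul_comm]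
  congr 2
  ring

/-- Bounded functions in the local Orlicz–Campanato space multiply the Lipschitz space. -/
theorem exists_multiplier_bound {n : ℕ} (hn : 0 < n) {p : ℝ} (hp : p ∈ Set.Ioo (0 : ℝ) 1) :
    ∃ C > (0 : ℝ), ∀ (g : EuclideanSpace ℝ (Fin n) → ℝ) (M K : ℝ),
      0 ≤ M → 0 ≤ K → LocallyIntegrable g → (∀ᵐ x, |g x| ≤ M) → MemOrlCampWith n p K g →
      ∀ (f : EuclideanSpace ℝ (Fin n) → ℝ) (Mf L : ℝ), 0 ≤ Mf → 0 ≤ L →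
        MemLipWith n ((n : ℝ) * (1 / p - 1)) Mf L f →
        ∃ Mg Lg : ℝ, 0 ≤ Mg ∧ 0 ≤ Lg ∧
          MemLipWith n ((n : ℝ) * (1 / p - 1)) Mg Lg (fun x => g x * f x) ∧
          Mg + Lg ≤ C * (M + K) * (Mf + L) := by
  have hβ := rpow_smoothness_pos hn hp
  set v := (volume (Metric.ball (0 : EuclideanSpace ℝ (Fin n)) 1)).toReal with hv
  have hv0 : 0 < v := volume_unitBall_toReal_pos n
  set w := v ^ (1 / p) with hw
  have hw0 : 0 < w := by positivity
  set k := ⌊(n : ℝ) * (1 / p - 1)⌋₊ + 1 with hk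
  obtain ⟨C, hC, hCb⟩ := exists_lipschitz_representative n k (Nat.succ_pos _) hβ
    (R := min 1 (1 / v)) (by positivity)
  refine ⟨1 + 2 ^ k * 2 ^ (k ^ 2) * 2 ^ (k ^ 2) * (1 + C * (1 + w)), by positivity,
    fun g M K hM hK hg hgM hgK f Mf L hMf hL hf => ?_⟩
  obtain ⟨f₀, hf₀c, hff₀, hf₀M, hf₀L⟩ := hf
  obtain ⟨u, huc, hgu, huM, huL⟩ := hCb M (K * w) g (by positivity) hg hgM fun x₀ r hr hrR => by
    obtain ⟨P, hPs, hP⟩ := exists_minimizing_polynomial ⌊(n : ℝ) * (1 / p - 1)⌋₊ hg x₀ hr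
    refine ⟨P, Nat.lt_succ_of_le hPs, ?_⟩
    have hr1 : r < 1 := hrR.trans_le (min_le_left _ _)
    have hrv : r * v < 1 := (lt_div_iff₀ hv0).1 (hrR.trans_le (min_le_right _ _))
    have hvol : (volume (Metric.ball x₀ r)).toReal < 1 := by
      rw [volume_ball_toReal x₀ hr]
      refine lt_of_le_of_lt ?_ hrv
      gcongr
      exact pow_le_of_le_one hr.le hr1.le hn.ne'
    refine (hgK.1 x₀ r hr hvol P hPs hP).trans ?_
    rw [mul_assoc K w, hw, hv, ← volume_ball_rpow p x₀ hr]
    exact mul_le_mul_of_nonneg_left (luxNorm_indicator_ball_le hp.1 x₀ hr) hK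
  refine ⟨M * Mf, 2 ^ k * (2 ^ (k ^ 2) * (M + C * (M + K * w))) * (2 ^ (k ^ 2) * (Mf + L)),
    by positivity, by positivity, ⟨fun x => u x * f₀ x, huc.mul hf₀c, ?_, fun x => ?_,
    fun x h hh => ?_⟩, ?_⟩
  · filter_upwards [hff₀, hgu] with x h1 h2
    rw [h1, h2]
  · rw [abs_mul]
    exact mul_le_mul (huM x) (hf₀M x) (abs_nonneg _) hM
  · exact abs_iterDiff_mul_le (Nat.succ_pos _) hMf hL hM (by positivity) hf₀M huM hh
      (fun x => hf₀L x h hh) (fun x => huL x h hh) x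
  · have h1 : M * Mf ≤ (M + K) * (Mf + L) := by gcongr <;> linarith
    have h2 : M + C * (M + K * w) ≤ (1 + C * (1 + w)) * (M + K) := by
      have : 0 ≤ C * w * M := by positivity
      have : 0 ≤ C * K := by positivity
      linarith
    calc _ ≤ (M + K) * (Mf + L) + 2 ^ k * (2 ^ (k ^ 2) * ((1 + C * (1 + w)) * (M + K))) *
          (2 ^ (k ^ 2) * (Mf + L)) := by gcongr
      _ = _ := by ring

theorem exists_mvEval_eq_multilinear {n j : ℕ}
    (m : ContinuousMultilinearMap ℝ (fun _ : Fin j => EuclideanSpace ℝ (Fin n)) ℝ) (c : ℝ)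
    (x₀ : EuclideanSpace ℝ (Fin n)) :
    ∃ P : MvPolynomial (Fin n) ℝ, P.totalDegree ≤ j ∧
      ∀ y, mvEval y P = m fun _ => c • (y - x₀) := by
  let e : Fin n → EuclideanSpace ℝ (Fin n) := fun i => EuclideanSpace.single i 1
  refine ⟨∑ a : Fin j → Fin n, MvPolynomial.C (m fun l => e (a l)) *
    ∏ l, (MvPolynomial.C c * (MvPolynomial.X (a l) - MvPolynomial.C (x₀ (a l)))), ?_, fun y => ?_⟩
  · refine MvPolynomial.totalDegree_finsetSum_le fun a _ => ?_
    refine (MvPolynomial.totalDegree_mul _ _).trans ?_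
    rw [MvPolynomial.totalDegree_C, zero_add]
    refine (MvPolynomial.totalDegree_finsetProd _ _).trans ?_
    refine (Finset.sum_le_card_nsmul _ _ 1 fun l _ => ?_).trans (by simp)
    refine (MvPolynomial.totalDegree_mul _ _).trans ?_
    rw [MvPolynomial.totalDegree_C, zero_add]
    exact (MvPolynomial.totalDegree_sub_C_le _ _).trans (MvPolynomial.totalDegree_X _).le
  · have hy : c • (y - x₀) = ∑ i, (c * (y i - x₀ i)) • e i := by
      ext l
      simp [e, Finset.sum_apply, Pi.single_apply]
    rw [hy, ← m.coe_coe, MultilinearMap.map_sum]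
    simp only [mvEval, map_sum, map_mul, map_prod, MvPolynomial.eval_C, MvPolynomial.eval_X,
      map_sub, MultilinearMap.map_smul_univ, smul_eq_mul]
    refine Finset.sum_congr rfl fun a _ => ?_
    rw [mul_comm]

theorem abs_sub_taylor_le {n m : ℕ} {f : EuclideanSpace ℝ (Fin n) → ℝ} {B : ℝ}
    (hf : ContDiff ℝ (m + 1) f) (hB : ∀ x, ‖iteratedFDeriv ℝ (m + 1) f x‖ ≤ B)
    (x y : EuclideanSpace ℝ (Fin n)) :
    |f (x + y) - ∑ j ∈ Finset.range (m + 1),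
      (j.factorial : ℝ)⁻¹ * iteratedFDeriv ℝ j f x (fun _ => y)| ≤ B * ‖y‖ ^ (m + 1) := by
  rw [map_add_eq_sum_add_integral_iteratedFDeriv fun t _ => hf.contDiffAt]
  simp only [smul_eq_mul, add_sub_cancel_left]
  have hB0 : 0 ≤ B := (norm_nonneg _).trans (hB 0)
  have h1 : ‖∫ t in (0 : ℝ)..1, (1 - t) ^ m * iteratedFDeriv ℝ (m + 1) f (x + t • y) fun _ => y‖ ≤
      B * ‖y‖ ^ (m + 1) * |1 - 0| := by
    refine intervalIntegral.norm_integral_le_of_norm_le_const fun t ht => ?_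
    rw [Set.uIoc_of_le zero_le_one] at ht
    have h2 : ‖iteratedFDeriv ℝ (m + 1) f (x + t • y) fun _ => y‖ ≤ B * ‖y‖ ^ (m + 1) := by
      refine (ContinuousMultilinearMap.le_opNorm _ _).trans ?_
      rw [Finset.prod_const, Finset.card_univ, Fintype.card_fin]
      gcongr
      exact hB _
    rw [norm_mul, norm_pow, Real.norm_of_nonneg (by linarith [ht.2])]
    have h3 : (1 - t) ^ m ≤ 1 := pow_le_one₀ (by linarith [ht.2]) (by linarith [ht.1])
    have h4 : 0 ≤ (1 - t) ^ m := pow_nonneg (by linarith [ht.2]) _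
    nlinarith [norm_nonneg (iteratedFDeriv ℝ (m + 1) f (x + t • y) fun _ => y)]
  rw [sub_zero, abs_one, mul_one] at h1
  have h5 : (m.factorial : ℝ)⁻¹ ≤ 1 :=
    inv_le_one_of_one_le₀ (by exact_mod_cast m.factorial_pos)
  rw [abs_mul, abs_of_nonneg (by positivity)]
  exact (mul_le_of_le_one_left (abs_nonneg _) h5).trans h1

theorem integrable_smul_of_hasCompactSupport {n : ℕ} {F : Type*} [NormedAddCommGroup F]
    [NormedSpace ℝ F] {w : EuclideanSpace ℝ (Fin n) → ℝ} {a : EuclideanSpace ℝ (Fin n) → F}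
    (hw : Continuous w) (ha : Continuous a) (hs : HasCompactSupport a) :
    Integrable fun z => w z • a z :=
  (hw.smul ha).integrable_of_hasCompactSupport hs.smul_left

theorem exists_polynomial_approx_average {n k : ℕ} (hk : 0 < k)
    {ψ : EuclideanSpace ℝ (Fin n) → ℝ} (hψ : IsUnitBump ψ) :
    ∃ C, 0 ≤ C ∧ ∀ (f : EuclideanSpace ℝ (Fin n) → ℝ) (A τ : ℝ) (x₀ : EuclideanSpace ℝ (Fin n)),
      Continuous f → 0 < τ → (∀ x, dist x x₀ < 2 * τ → |f x| ≤ A) →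
      ∃ P : MvPolynomial (Fin n) ℝ, P.totalDegree < k ∧ ∀ y, dist y x₀ ≤ τ →
        |(∫ z, ψ z * f (y + τ • z)) - mvEval y P| ≤ C * A * (dist y x₀ / τ) ^ k := by
  obtain ⟨m, rfl⟩ : ∃ m, k = m + 1 := ⟨k - 1, by omega⟩
  have hcd : ContDiff ℝ (m + 1) ψ := by exact_mod_cast hψ.contDiff (m + 1)
  obtain ⟨B, hB⟩ := (hcd.continuous_iteratedFDeriv (m := m + 1) (by norm_cast)).bounded_above_of_compact_support
    (hψ.hasCompactSupport.iteratedFDeriv (𝕜 := ℝ) (m + 1))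
  have hB0 : 0 ≤ B := (norm_nonneg _).trans (hB 0)
  have hts : tsupport ψ ⊆ Metric.closedBall 0 1 := by
    refine closure_minimal (fun z hz => ?_) Metric.isClosed_closedBall
    rw [mem_closedBall_zero_iff]
    by_contra h
    exact hz (hψ.eq_zero z (not_le.1 h).le)
  set V := (volume (Metric.ball (0 : EuclideanSpace ℝ (Fin n)) 2)).toReal with hV
  refine ⟨B * V, by positivity, fun f A τ x₀ hf hτ hA => ?_⟩
  set w : EuclideanSpace ℝ (Fin n) → ℝ := fun z => f (x₀ + τ • z) with hw
  have hwc : Continuous w := by fun_prop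
  have hwA : ∀ z, ‖z‖ < 2 → |w z| ≤ A := fun z hz => hA _ (by
    rw [dist_eq_norm, add_sub_cancel_left, norm_smul, Real.norm_of_nonneg hτ.le]; nlinarith)
  have hA0 : 0 ≤ A := (abs_nonneg _).trans (hwA 0 (by simp))
  have h_int : ∀ j < m + 1, Integrable fun z => w z • iteratedFDeriv ℝ j ψ z := fun j hj =>
    integrable_smul_of_hasCompactSupport hwc
      (hcd.continuous_iteratedFDeriv (by exact_mod_cast hj.le))
      (hψ.hasCompactSupport.iteratedFDeriv (𝕜 := ℝ) j)
  choose Q hQdeg hQ using fun j => exists_mvEval_eq_multilinear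
    (∫ z, w z • iteratedFDeriv ℝ j ψ z) (-τ⁻¹) x₀
  refine ⟨∑ j ∈ Finset.range (m + 1), MvPolynomial.C ((j.factorial : ℝ)⁻¹) * Q j, ?_,
    fun y hy => ?_⟩
  · refine Nat.lt_succ_of_le (MvPolynomial.totalDegree_finsetSum_le fun j hj => ?_)
    refine (MvPolynomial.totalDegree_mul _ _).trans ?_
    rw [MvPolynomial.totalDegree_C, zero_add]
    exact (hQdeg j).trans (Nat.lt_succ_iff.1 (Finset.mem_range.1 hj))
  set v : EuclideanSpace ℝ (Fin n) := -τ⁻¹ • (y - x₀) with hv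
  have hvn : ‖v‖ = dist y x₀ / τ := by
    rw [hv, norm_smul, norm_neg, norm_inv, Real.norm_of_nonneg hτ.le, dist_eq_norm]
    ring
  have hv1 : ‖v‖ ≤ 1 := by rw [hvn]; exact (div_le_one hτ).2 hy
  have hyv : ∀ z, y + τ • (z + v) = x₀ + τ • z := by
    intro z
    rw [hv, smul_add, smul_smul, mul_neg, mul_inv_cancel₀ hτ.ne', neg_one_smul]
    abel
  have e1 : ∫ z, ψ z * f (y + τ • z) = ∫ z, ψ (z + v) * w z := by
    rw [← integral_add_right_eq_self _ v]
    simp only [hyv, hw]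
  have happ : ∀ j < m + 1, ∫ z, w z * iteratedFDeriv ℝ j ψ z (fun _ => v) =
      (∫ z, w z • iteratedFDeriv ℝ j ψ z) fun _ => v := by
    intro j hj
    have := (ContinuousMultilinearMap.apply ℝ (fun _ : Fin j => EuclideanSpace ℝ (Fin n)) ℝ
      (fun _ => v)).integral_comp_comm (h_int j hj)
    simpa using this
  have h_int' : ∀ j < m + 1, Integrable fun z => w z * iteratedFDeriv ℝ j ψ z (fun _ => v) := by
    intro j hj
    have := (ContinuousMultilinearMap.apply ℝ (fun _ : Fin j => EuclideanSpace ℝ (Fin n)) ℝ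
      (fun _ => v)).integrable_comp (h_int j hj)
    simpa using this
  have e2 : mvEval y (∑ j ∈ Finset.range (m + 1), MvPolynomial.C ((j.factorial : ℝ)⁻¹) * Q j) =
      ∫ z, ∑ j ∈ Finset.range (m + 1),
        (j.factorial : ℝ)⁻¹ * (w z * iteratedFDeriv ℝ j ψ z (fun _ => v)) := by
    rw [integral_finsetSum _ fun j hj => (h_int' j (Finset.mem_range.1 hj)).const_mul _]
    have : mvEval y (∑ j ∈ Finset.range (m + 1), MvPolynomial.C ((j.factorial : ℝ)⁻¹) * Q j) =
        ∑ j ∈ Finset.range (m + 1), (j.factorial : ℝ)⁻¹ * mvEval y (Q j) := by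
      simp [mvEval]
    rw [this]
    refine Finset.sum_congr rfl fun j hj => ?_
    rw [integral_const_mul, happ j (Finset.mem_range.1 hj), hQ]
  have hint1 : Integrable fun z => ψ (z + v) * w z := by
    have := (hψ.integrable_mul (w := fun z => f (y + τ • z))
      (by exact Continuous.locallyIntegrable (by fun_prop))).comp_add_right v
    simpa only [hyv] using this
  rw [e1, e2, ← integral_sub hint1 (integrable_finsetSum _ fun j hj =>
    (h_int' j (Finset.mem_range.1 hj)).const_mul _), ← hvn]
  have hpt : ∀ z, ψ (z + v) * w z - ∑ j ∈ Finset.range (m + 1),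
        (j.factorial : ℝ)⁻¹ * (w z * iteratedFDeriv ℝ j ψ z (fun _ => v)) =
      w z * (ψ (z + v) - ∑ j ∈ Finset.range (m + 1),
        (j.factorial : ℝ)⁻¹ * iteratedFDeriv ℝ j ψ z (fun _ => v)) := by
    intro z
    rw [mul_sub, Finset.mul_sum, mul_comm (w z)]
    congr 1
    refine Finset.sum_congr rfl fun j _ => ?_
    ring
  simp only [hpt]
  have hzero : ∀ z ∉ Metric.ball (0 : EuclideanSpace ℝ (Fin n)) 2,
      w z * (ψ (z + v) - ∑ j ∈ Finset.range (m + 1),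
        (j.factorial : ℝ)⁻¹ * iteratedFDeriv ℝ j ψ z (fun _ => v)) = 0 := by
    intro z hz
    rw [mem_ball_zero_iff, not_lt] at hz
    have h1 : ψ (z + v) = 0 := hψ.eq_zero _ (by
      have := norm_sub_le (z + v) v
      rw [add_sub_cancel_right] at this
      linarith)
    have h2 : ∀ j, iteratedFDeriv ℝ j ψ z = 0 := fun j => by
      by_contra h
      have := hts (support_iteratedFDeriv_subset j h)
      rw [mem_closedBall_zero_iff] at this
      linarith
    simp [h1, h2]
  rw [← setIntegral_eq_integral_of_forall_compl_eq_zero hzero]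
  have hfin : volume (Metric.ball (0 : EuclideanSpace ℝ (Fin n)) 2) < ⊤ := measure_ball_lt_top
  have hbound : ∀ z ∈ Metric.ball (0 : EuclideanSpace ℝ (Fin n)) 2,
      ‖w z * (ψ (z + v) - ∑ j ∈ Finset.range (m + 1),
        (j.factorial : ℝ)⁻¹ * iteratedFDeriv ℝ j ψ z (fun _ => v))‖ ≤
        A * (B * ‖v‖ ^ (m + 1)) := by
    intro z hz
    rw [norm_mul]
    exact mul_le_mul (hwA z (mem_ball_zero_iff.1 hz)) (abs_sub_taylor_le hcd hB z v)
      (norm_nonneg _) hA0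
  refine (norm_setIntegral_le_of_norm_le_const hfin hbound).trans (le_of_eq ?_)
  rw [Measure.real, ← hV]
  ring

theorem exists_polynomial_approx_reproAvg {n k : ℕ} (hk : 0 < k)
    {ψ : EuclideanSpace ℝ (Fin n) → ℝ} (hψ : IsUnitBump ψ) :
    ∃ C, 0 ≤ C ∧ ∀ (f : EuclideanSpace ℝ (Fin n) → ℝ) (A t : ℝ) (x₀ : EuclideanSpace ℝ (Fin n)),
      Continuous f → 0 < t → (∀ x, dist x x₀ < 2 * k * t → |f x| ≤ A) →
      ∃ P : MvPolynomial (Fin n) ℝ, P.totalDegree < k ∧ ∀ y, dist y x₀ ≤ t →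
        |reproAvg k ψ t f y - mvEval y P| ≤ C * A * (dist y x₀ / t) ^ k := by
  obtain ⟨C, hC, hCb⟩ := exists_polynomial_approx_average hk hψ
  refine ⟨k * (2 ^ k * C), by positivity, fun f A t x₀ hf ht hA => ?_⟩
  have hA0 : 0 ≤ A := (abs_nonneg _).trans (hA x₀ (by rw [dist_self]; positivity))
  have hex : ∀ i : ℕ, ∃ P : MvPolynomial (Fin n) ℝ, P.totalDegree < k ∧ (i < k →
      ∀ y, dist y x₀ ≤ t → |(∫ z, ψ z * f (y + (((i : ℝ) + 1) * t) • z)) - mvEval y P| ≤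
        C * A * (dist y x₀ / t) ^ k) := by
    intro i
    by_cases hi : i < k
    · have hik : (i : ℝ) + 1 ≤ k := by exact_mod_cast hi
      have hi0 : (0 : ℝ) ≤ i := i.cast_nonneg
      have hτt : t ≤ ((i : ℝ) + 1) * t := by nlinarith
      obtain ⟨P, hPk, hP⟩ := hCb f A (((i : ℝ) + 1) * t) x₀ hf (by positivity) fun x hx =>
        hA x (hx.trans_le (by rw [mul_assoc]; gcongr))
      refine ⟨P, hPk, fun _ y hy => (hP y (hy.trans hτt)).trans ?_⟩
      gcongr
    · exact ⟨0, by simpa using hk, fun h => absurd h hi⟩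
  choose P hPk hP using hex
  refine ⟨∑ i ∈ Finset.range k, MvPolynomial.C (shiftCoeff k i) * P i, ?_, fun y hy => ?_⟩
  · rw [← Nat.le_sub_one_iff_lt hk]
    refine MvPolynomial.totalDegree_finsetSum_le fun i _ => ?_
    refine (MvPolynomial.totalDegree_mul _ _).trans ?_
    rw [MvPolynomial.totalDegree_C, zero_add]
    exact Nat.le_sub_one_of_lt (hPk i)
  · have e : mvEval y (∑ i ∈ Finset.range k, MvPolynomial.C (shiftCoeff k i) * P i) =
        ∑ i ∈ Finset.range k, shiftCoeff k i * mvEval y (P i) := by simp [mvEval]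
    rw [e, reproAvg, ← Finset.sum_sub_distrib]
    simp only [← mul_sub]
    refine (Finset.abs_sum_le_sum_abs _ _).trans ?_
    refine (Finset.sum_le_card_nsmul _ _ (2 ^ k * (C * A * (dist y x₀ / t) ^ k))
      fun i hi => ?_).trans (le_of_eq ?_)
    · rw [abs_mul]
      exact mul_le_mul (abs_shiftCoeff_le k i) (hP i (Finset.mem_range.1 hi) y hy)
        (abs_nonneg _) (by positivity)
    · rw [Finset.card_range, nsmul_eq_mul]; ring

/-- Whitney-type local polynomial approximation of Lipschitz functions. -/
theorem exists_whitney_approx {n k : ℕ} (hk : 0 < k) {β : ℝ} (hβ : 0 < β) (hβk : β < k) {M L : ℝ}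
    (hL : 0 ≤ L) {f : EuclideanSpace ℝ (Fin n) → ℝ} (hf : Continuous f) (hM : ∀ x, |f x| ≤ M)
    (hD : ∀ x h, h ≠ 0 → |iterDiff h f k x| ≤ L * ‖h‖ ^ β) :
    ∃ D, 0 < D ∧ ∀ x₀ r, 0 < r → ∃ P : MvPolynomial (Fin n) ℝ, P.totalDegree < k ∧
      ∀ y, dist y x₀ < r → |f y - mvEval y P| ≤ D * r ^ β := by
  obtain ⟨ψ, hψ⟩ := exists_isUnitBump n
  obtain ⟨C, hC, hCb⟩ := exists_polynomial_approx_reproAvg hk hψ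
  have hk1 : (1 : ℝ) ≤ k := by exact_mod_cast hk
  obtain ⟨N, hN1, hN2⟩ : ∃ N : ℝ, C * (2 * k) ^ k * N ^ (-((k : ℝ) - β)) ≤ 1 / 2 ∧ 2 * k ≤ N := by
    have h1 := (tendsto_rpow_neg_atTop (sub_pos.2 hβk)).const_mul (C * (2 * (k : ℝ)) ^ k)
    rw [mul_zero] at h1
    exact ((h1.eventually (ge_mem_nhds (by norm_num : (0 : ℝ) < 1 / 2))).and
      (Filter.eventually_ge_atTop _)).exists
  have hN : 0 < N := by linarith
  set D := max (M + 1) (2 * (L * N ^ β)) with hDdef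
  have hM0 : 0 ≤ M := (abs_nonneg _).trans (hM 0)
  have hD0 : 0 < D := lt_of_lt_of_le (by linarith) (le_max_left _ _)
  have key : ∀ m : ℕ, ∀ x₀ r, 0 < r → 1 ≤ N ^ m * r → ∃ P : MvPolynomial (Fin n) ℝ,
      P.totalDegree < k ∧ ∀ y, dist y x₀ < r → |f y - mvEval y P| ≤ D * r ^ β := by
    intro m
    induction m with
    | zero =>
      intro x₀ r hr h1
      rw [pow_zero, one_mul] at h1
      refine ⟨0, by simpa using hk, fun y _ => ?_⟩
      have h2 : 1 ≤ r ^ β := Real.one_le_rpow h1 hβ.le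
      have h3 : M + 1 ≤ D := le_max_left _ _
      have h4 := hM y
      simp only [mvEval, map_zero, sub_zero]
      nlinarith
    | succ m ih =>
      intro x₀ r hr h1
      obtain ⟨P, hPk, hP⟩ := ih x₀ (N * r) (by positivity) (by rwa [← mul_assoc, ← pow_succ])
      set t := N * r / (2 * k) with ht
      have ht0 : 0 < t := by positivity
      have htr : r ≤ t := by rw [ht, le_div_iff₀ (by positivity)]; nlinarith
      have e2 : 2 * k * t = N * r := by rw [ht]; field_simp
      have hPc := continuous_mvEval P
      obtain ⟨Q, hQk, hQ⟩ := hCb (fun x => f x - mvEval x P) (D * (N * r) ^ β) t x₀ (hf.sub hPc) ht0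
        fun x hx => hP x (by rwa [e2] at hx)
      refine ⟨P + Q, (MvPolynomial.totalDegree_add _ _).trans_lt (max_lt hPk hQk), fun y hy => ?_⟩
      have h2 := abs_sub_reproAvg_le hψ ht0 hβ.le hL hk hf.locallyIntegrable hD y
      have h3 := hQ y (hy.le.trans htr)
      rw [reproAvg_sub hψ ht0 hf.locallyIntegrable hPc.locallyIntegrable,
        reproAvg_mvEval hψ ht0 P hPk] at h3
      have h4 : L * t ^ β ≤ D / 2 * r ^ β := by
        have h5 : t ≤ N * r := by
          rw [← e2]; nlinarith
        calc L * t ^ β ≤ L * (N * r) ^ β := by gcongr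
          _ = L * N ^ β * r ^ β := by rw [Real.mul_rpow hN.le hr.le]; ring
          _ ≤ D / 2 * r ^ β := by
            have h6 : 2 * (L * N ^ β) ≤ D := le_max_right _ _
            gcongr
            linarith
      have h7 : C * (D * (N * r) ^ β) * (dist y x₀ / t) ^ k ≤ D / 2 * r ^ β := by
        have e3 : r / t = 2 * k / N := by rw [ht]; field_simp
        calc C * (D * (N * r) ^ β) * (dist y x₀ / t) ^ k
            ≤ C * (D * (N * r) ^ β) * (r / t) ^ k := by gcongr
          _ = C * (2 * k) ^ k * N ^ (-((k : ℝ) - β)) * (D * r ^ β) := by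
            rw [e3, div_pow, Real.mul_rpow hN.le hr.le, neg_sub, Real.rpow_sub hN,
              Real.rpow_natCast]
            ring
          _ ≤ 1 / 2 * (D * r ^ β) := by gcongr
          _ = _ := by ring
      have h8 := h3.trans h7
      have h9 := h2.trans h4
      have e4 : mvEval y (P + Q) = mvEval y P + mvEval y Q := by simp [mvEval]
      rw [e4]
      rw [abs_le] at h8 h9 ⊢
      constructor <;> linarith [h8.1, h8.2, h9.1, h9.2]
  refine ⟨D, hD0, fun x₀ r hr => ?_⟩
  obtain ⟨m, hm⟩ := pow_unbounded_of_one_lt (1 / r) (show 1 < N by linarith)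
  exact key m x₀ r hr ((div_lt_iff₀ hr).1 hm).le

theorem integral_abs_sub_minimizing_le {n s : ℕ} {u : EuclideanSpace ℝ (Fin n) → ℝ}
    (hu : Continuous u) {x₀ : EuclideanSpace ℝ (Fin n)} {r ε : ℝ} (hε : 0 < ε)
    {P Q : MvPolynomial (Fin n) ℝ} (hPs : P.totalDegree ≤ s) (hQs : Q.totalDegree ≤ s)
    (hP : ∀ R : MvPolynomial (Fin n) ℝ, R.totalDegree ≤ s →
      ∫ x in Metric.ball x₀ r, (u x - mvEval x P) * mvEval x R = 0)
    (hQ : ∀ x, dist x x₀ < r → |u x - mvEval x Q| ≤ ε) :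
    ∫ x in Metric.ball x₀ r, |u x - mvEval x P| ≤
      (volume (Metric.ball x₀ r)).toReal * ε := by
  have hPc := continuous_mvEval P
  have hQc := continuous_mvEval Q
  have h0 : ∫ x in Metric.ball x₀ r, (u x - mvEval x P) * (mvEval x P - mvEval x Q) = 0 := by
    have := hP (P - Q) ((MvPolynomial.totalDegree_sub _ _).trans (max_le hPs hQs))
    simpa only [mvEval, map_sub] using this
  have hI : ∀ {F : EuclideanSpace ℝ (Fin n) → ℝ}, Continuous F →
      Integrable F (volume.restrict (Metric.ball x₀ r)) :=
    fun hF => integrableOn_ball_of_continuous hF x₀ r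
  have hpt : ∀ x ∈ Metric.ball x₀ r, |u x - mvEval x P| ≤
      ε - (u x - mvEval x P) * (mvEval x P - mvEval x Q) / ε := by
    intro x hx
    have h1 := hQ x hx
    have h2 : (u x - mvEval x Q) ^ 2 ≤ ε ^ 2 := sq_le_sq' (by linarith [(abs_le.1 h1).1])
      (abs_le.1 h1).2
    have h3 := sq_abs (u x - mvEval x P)
    have h4 := sq_nonneg (|u x - mvEval x P| - ε)
    have h5 := sq_nonneg (mvEval x P - mvEval x Q)
    rw [le_sub_iff_add_le, ← le_sub_iff_add_le', div_le_iff₀ hε]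
    nlinarith
  calc ∫ x in Metric.ball x₀ r, |u x - mvEval x P|
      ≤ ∫ x in Metric.ball x₀ r,
        (ε - (u x - mvEval x P) * (mvEval x P - mvEval x Q) / ε) :=
        setIntegral_mono_on (hI (by fun_prop)) (hI (by fun_prop)) Metric.isOpen_ball.measurableSet
          hpt
    _ = _ := by
        rw [integral_sub (hI continuous_const) (hI (by fun_prop)), integral_div, h0]
        simp [Measure.real]

/-- A bounded function with a Lipschitz representative is in the local Orlicz–Campanato space. -/
theorem exists_memOrlCampWith {n : ℕ} (hn : 0 < n) {p : ℝ} (hp : p ∈ Set.Ioo (0 : ℝ) 1)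
    {g : EuclideanSpace ℝ (Fin n) → ℝ} {M L : ℝ} (hM : 0 ≤ M) (hL : 0 ≤ L)
    (hg : MemLipWith n ((n : ℝ) * (1 / p - 1)) M L g) : ∃ K, 0 ≤ K ∧ MemOrlCampWith n p K g := by
  have hβ := rpow_smoothness_pos hn hp
  obtain ⟨u, huc, hgu, huM, huL⟩ := hg
  obtain ⟨D, hD, hDu⟩ := exists_whitney_approx (Nat.succ_pos _) hβ
    (by exact_mod_cast Nat.lt_floor_add_one _) hL huc huM huL
  set v := (volume (Metric.ball (0 : EuclideanSpace ℝ (Fin n)) 1)).toReal with hv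
  have hv0 : 0 < v := volume_unitBall_toReal_pos n
  set c : ℝ := (1 / 2) ^ (1 / p) with hc
  have hc0 : 0 < c := by positivity
  set w := v ^ (1 / p) with hw
  have hw0 : 0 < w := by positivity
  have hcongr : ∀ (F : EuclideanSpace ℝ (Fin n) → ℝ → ℝ) x₀ r,
      ∫ x in Metric.ball x₀ r, F x (g x) = ∫ x in Metric.ball x₀ r, F x (u x) := by
    intro F x₀ r
    refine integral_congr_ae (ae_restrict_of_ae ?_)
    filter_upwards [hgu] with x hx
    rw [hx]
  have hK1 : 0 ≤ D * v / (w * c) := by positivity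
  have hK2 : 0 ≤ M * 2 / c := by positivity
  refine ⟨D * v / (w * c) + M * 2 / c, add_nonneg hK1 hK2, fun x₀ r hr hvol P hPs hP => ?_,
    fun x₀ r hr hvol => ?_⟩
  · have hlux := le_luxNorm_of_volume_lt_one hp x₀ hvol
    obtain ⟨Q, hQk, hQ⟩ := hDu x₀ r hr
    rw [hcongr fun x a => |a - mvEval x P|]
    have h1 := integral_abs_sub_minimizing_le huc (mul_pos hD (Real.rpow_pos_of_pos hr _)) hPs
      (Nat.lt_succ_iff.1 hQk) (fun R hR =>
        (hcongr (fun x a => (a - mvEval x P) * mvEval x R) x₀ r).symm.trans (hP R hR)) hQ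
    refine h1.trans ?_
    have h2 : (volume (Metric.ball x₀ r)).toReal * (D * r ^ ((n : ℝ) * (1 / p - 1))) =
        D * v / (w * c) * (c * (volume (Metric.ball x₀ r)).toReal ^ (1 / p)) := by
      rw [volume_ball_rpow p x₀ hr, volume_ball_toReal x₀ hr, ← hv, ← hw]
      field_simp
    rw [h2]
    have hlux0 := (mul_nonneg hc0.le (Real.rpow_nonneg ENNReal.toReal_nonneg _)).trans hlux
    refine (mul_le_mul_of_nonneg_left hlux hK1).trans (mul_le_mul_of_nonneg_right ?_ hlux0)
    linarith
  · have hlux := le_luxNorm_of_one_le_volume hp x₀ hvol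
    have hlux0 := (mul_nonneg (by positivity) ENNReal.toReal_nonneg).trans hlux
    rw [hcongr fun _ a => |a|]
    have h1 : ∫ x in Metric.ball x₀ r, |u x| ≤ M * (volume (Metric.ball x₀ r)).toReal := by
      refine (le_abs_self _).trans ?_
      have hfin : volume (Metric.ball x₀ r) < ⊤ := measure_ball_lt_top
      have hb : ∀ x ∈ Metric.ball x₀ r, ‖|u x|‖ ≤ M := fun x _ => by
        rw [Real.norm_eq_abs, abs_abs]
        exact huM x
      exact norm_setIntegral_le_of_norm_le_const hfin hb
    calc _ ≤ M * (volume (Metric.ball x₀ r)).toReal := h1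
      _ = M * 2 / c * (c / 2 * (volume (Metric.ball x₀ r)).toReal) := by field_simp
      _ ≤ M * 2 / c * luxNorm n p ((Metric.ball x₀ r).indicator fun _ => (1 : ℝ)) := by gcongr
      _ ≤ _ := mul_le_mul_of_nonneg_right (by linarith) hlux0

theorem memLipWith_one (n : ℕ) (β : ℝ) : MemLipWith n β 1 0 fun _ => 1 := by
  refine ⟨fun _ => 1, continuous_const, Filter.Eventually.of_forall fun _ => rfl, by simp,
    fun x h _ => ?_⟩
  have := iterDiff_mvEval_eq_zero (n := n) (k := ⌊β⌋₊ + 1) (MvPolynomial.C 1)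
    (by rw [MvPolynomial.totalDegree_C]; exact Nat.succ_pos _) h x
  simp only [mvEval, MvPolynomial.eval_C] at this
  rw [this, abs_zero, zero_mul]

/-- Pointwise multiplier characterization for `Λ_{nα}(ℝⁿ)`, `α = 1/p − 1`, `p ∈ (0,1)`:
(1) there is a uniform `C > 0` such that any `g ∈ L^∞ ∩ L_loc^{Φ_p}` (with bounds `M`, `K`)
is a pointwise multiplier of `Λ_{nα}` with operator bound `C (M + K)`, i.e.
`‖gf‖_{Λ_{nα}} ≤ C(‖g‖_{L^∞} + ‖g‖_{L_loc^{Φ_p}}) ‖f‖_{Λ_{nα}}`; and conversely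
(2) every pointwise multiplier `g` of `Λ_{nα}` lies in `L^∞ ∩ L_loc^{Φ_p}`. -/
theorem stmt_11 (n : ℕ) (hn : 0 < n) (p : ℝ) (hp : p ∈ Set.Ioo (0 : ℝ) 1) :
    (∃ C > (0 : ℝ), ∀ (g : EuclideanSpace ℝ (Fin n) → ℝ) (M K : ℝ),
      0 ≤ M → 0 ≤ K → LocallyIntegrable g → (∀ᵐ x, |g x| ≤ M) → MemOrlCampWith n p K g →
      ∀ (f : EuclideanSpace ℝ (Fin n) → ℝ) (Mf L : ℝ), 0 ≤ Mf → 0 ≤ L →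
        MemLipWith n ((n : ℝ) * (1 / p - 1)) Mf L f →
        ∃ Mg Lg : ℝ, 0 ≤ Mg ∧ 0 ≤ Lg ∧
          MemLipWith n ((n : ℝ) * (1 / p - 1)) Mg Lg (fun x => g x * f x) ∧
          Mg + Lg ≤ C * (M + K) * (Mf + L)) ∧
    (∀ g : EuclideanSpace ℝ (Fin n) → ℝ, LocallyIntegrable g →
      (∃ C : ℝ, 0 ≤ C ∧ ∀ (f : EuclideanSpace ℝ (Fin n) → ℝ) (Mf L : ℝ), 0 ≤ Mf → 0 ≤ L →
        MemLipWith n ((n : ℝ) * (1 / p - 1)) Mf L f →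
        ∃ Mg Lg : ℝ, 0 ≤ Mg ∧ 0 ≤ Lg ∧
          MemLipWith n ((n : ℝ) * (1 / p - 1)) Mg Lg (fun x => g x * f x) ∧
          Mg + Lg ≤ C * (Mf + L)) →
      ∃ M K : ℝ, 0 ≤ M ∧ 0 ≤ K ∧ (∀ᵐ x, |g x| ≤ M) ∧ MemOrlCampWith n p K g) := by

  refine ⟨exists_multiplier_bound hn hp, fun g _ ⟨C, _, hC⟩ => ?_⟩
  obtain ⟨M, L, hM, hL, hg, -⟩ := hC (fun _ => 1) 1 0 zero_le_one le_rfl (memLipWith_one n _)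
  simp only [mul_one] at hg
  obtain ⟨K, hK, hgK⟩ := exists_memOrlCampWith hn hp hM hL hg
  obtain ⟨u, -, hgu, huM, -⟩ := hg
  refine ⟨M, K, hM, hK, ?_, hgK⟩
  filter_upwards [hgu] with x hx
  rw [hx]
  exact huM x
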